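/- arXiv:0709.2470 — 3 statements merged into one kernel-verified Lean document; each statement's English description precedes it below -/
import Mathlib

section
/- Every matrix representation 𝔸 of the cycle quiver with vertices 1,…,t (with an arbitrary fixed orientation of the arrows) over ℂ admits a regularizing decomposition: 𝔸 is isomorphic to a direct sum 𝔻₁ ⊕ … ⊕ 𝔻_k ⊕ ℙ in which each 𝔻_m is an indecomposable singular representation and ℙ is a regular representation; moreover such a decomposition is determined by 𝔸 uniquely up to isomorphism of summands (the multiset of isomorphism classes of the 𝔻_m and the isomorphism class of ℙ are uniquely determined). -/
open Matrix

namespace CycleQuiver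

/-! The cycle quiver has vertices `0, 1, …, t - 1` (representing `1, …, t`) and arrows
`α_i` joining vertex `i` and vertex `i + 1 (mod t)` for each `i`.  The orientation is
given by `ε : Fin t → Bool`: `ε i = true` means `α_i` is oriented clockwise
(`i → i+1`), and `ε i = false` means counterclockwise (`i+1 → i`). -/

/-- The cyclic successor of a vertex. -/
def next {t : ℕ} (v : Fin t) : Fin t := ⟨((v : ℕ) + 1) % t, Nat.mod_lt _ v.pos⟩

/-- Source vertex of the arrow `α_i`. -/
def src {t : ℕ} (ε : Fin t → Bool) (i : Fin t) : Fin t := if ε i then i else next i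

/-- Target vertex of the arrow `α_i`. -/
def tgt {t : ℕ} (ε : Fin t → Bool) (i : Fin t) : Fin t := if ε i then next i else i

/-- A matrix representation of the cycle quiver: a dimension at each vertex and, for
each arrow, a (target-dim) × (source-dim) complex matrix. -/
structure Rep (t : ℕ) (ε : Fin t → Bool) where
  d : Fin t → ℕ
  A : ∀ i : Fin t, Matrix (Fin (d (tgt ε i))) (Fin (d (src ε i))) ℂ

variable {t : ℕ} {ε : Fin t → Bool}

/-- Isomorphism of representations: invertible matrices `S v` (with two-sided
inverses `T v`) at each vertex with `Y.A i = S (tgt i) * X.A i * (S (src i))⁻¹`. -/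
def Iso (X Y : Rep t ε) : Prop :=
  ∃ (S : ∀ v, Matrix (Fin (Y.d v)) (Fin (X.d v)) ℂ)
    (T : ∀ v, Matrix (Fin (X.d v)) (Fin (Y.d v)) ℂ),
    (∀ v, S v * T v = 1) ∧ (∀ v, T v * S v = 1) ∧
    ∀ i, Y.A i = S (tgt ε i) * X.A i * T (src ε i)

/-- Arrow-wise block-diagonal direct sum of representations. -/
noncomputable def dsum (X Y : Rep t ε) : Rep t ε where
  d v := X.d v + Y.d v
  A i := Matrix.reindex finSumFinEquiv finSumFinEquiv
    (Matrix.fromBlocks (X.A i) 0 0 (Y.A i))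

/-- The zero representation. -/
def zero (t : ℕ) (ε : Fin t → Bool) : Rep t ε := ⟨fun _ => 0, fun _ => 0⟩

/-- Direct sum of a list of representations. -/
noncomputable def dsumList (L : List (Rep t ε)) : Rep t ε := L.foldr dsum (zero t ε)

/-- A representation is nonzero if some vertex has nonzero dimension. -/
def Nonzero (X : Rep t ε) : Prop := ∃ v, X.d v ≠ 0

/-- Indecomposability: nonzero and not isomorphic to a direct sum of two nonzero
representations. -/
def Indecomposable (X : Rep t ε) : Prop :=
  Nonzero X ∧ ¬ ∃ Y Z : Rep t ε, Nonzero Y ∧ Nonzero Z ∧ Iso X (dsum Y Z)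

/-- Regularity: all dimensions are equal and every matrix is (square and) invertible,
invertibility being expressed by a two-sided inverse. -/
def Regular (X : Rep t ε) : Prop :=
  (∀ v w : Fin t, X.d v = X.d w) ∧
  ∀ i : Fin t, ∃ B : Matrix (Fin (X.d (src ε i))) (Fin (X.d (tgt ε i))) ℂ,
    X.A i * B = 1 ∧ B * X.A i = 1

/-- Singular = not regular. -/
def Singular (X : Rep t ε) : Prop := ¬ Regular X

end CycleQuiver

namespace CycleQuiver

section Helpers

open CategoryTheory CategoryTheory.Limits

variable {t : ℕ} {ε : Fin t → Bool}

set_option linter.unusedVariables false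

/-- Morphisms of representations. -/
@[ext]
structure RHom (X Y : Rep t ε) where
  f : ∀ v, Matrix (Fin (Y.d v)) (Fin (X.d v)) ℂ
  comm : ∀ i, f (tgt ε i) * X.A i = Y.A i * f (src ε i)

instance catRep : Category (Rep t ε) where
  Hom X Y := RHom X Y
  id X := ⟨fun _ => 1, fun i => by simp⟩
  comp {X Y Z} a b := ⟨fun v => b.f v * a.f v, fun i => by
    rw [Matrix.mul_assoc, a.comm, ← Matrix.mul_assoc, b.comm, Matrix.mul_assoc]⟩
  id_comp a := by apply RHom.ext; funext v; exact Matrix.mul_one _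
  comp_id a := by apply RHom.ext; funext v; exact Matrix.one_mul _
  assoc a b c := by apply RHom.ext; funext v; exact (Matrix.mul_assoc _ _ _).symm

/-- Components of a morphism. -/
def cf {X Y : Rep t ε} (a : X ⟶ Y) (v : Fin t) : Matrix (Fin (Y.d v)) (Fin (X.d v)) ℂ :=
  RHom.f a v

theorem cf_comm {X Y : Rep t ε} (a : X ⟶ Y) (i : Fin t) :
    cf a (tgt ε i) * X.A i = Y.A i * cf a (src ε i) := RHom.comm a i

/-- Building a morphism. -/
def mkHom {X Y : Rep t ε} (f : ∀ v, Matrix (Fin (Y.d v)) (Fin (X.d v)) ℂ)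
    (h : ∀ i, f (tgt ε i) * X.A i = Y.A i * f (src ε i)) : X ⟶ Y := RHom.mk f h

@[simp] theorem cf_mkHom {X Y : Rep t ε} (f : ∀ v, Matrix (Fin (Y.d v)) (Fin (X.d v)) ℂ)
    (h) (v) : cf (mkHom f h : X ⟶ Y) v = f v := rfl

theorem hom_ext' {X Y : Rep t ε} {a b : X ⟶ Y} (h : ∀ v, cf a v = cf b v) : a = b :=
  RHom.ext (funext h)

@[simp] theorem cf_id (X : Rep t ε) (v) : cf (𝟙 X) v = 1 := rfl
@[simp] theorem cf_comp {X Y Z : Rep t ε} (a : X ⟶ Y) (b : Y ⟶ Z) (v) :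
    cf (a ≫ b) v = cf b v * cf a v := rfl

instance (X Y : Rep t ε) : Zero (X ⟶ Y) := ⟨mkHom (fun _ => 0) (fun i => by simp)⟩
instance (X Y : Rep t ε) : Add (X ⟶ Y) := ⟨fun a b => mkHom (fun v => cf a v + cf b v)
  (fun i => by rw [Matrix.add_mul, Matrix.mul_add, cf_comm, cf_comm])⟩
instance (X Y : Rep t ε) : Neg (X ⟶ Y) := ⟨fun a => mkHom (fun v => - cf a v)
  (fun i => by rw [Matrix.neg_mul, Matrix.mul_neg, cf_comm])⟩
instance (X Y : Rep t ε) : SMul ℂ (X ⟶ Y) := ⟨fun c a => mkHom (fun v => c • cf a v)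
  (fun i => by rw [Matrix.smul_mul, Matrix.mul_smul, cf_comm])⟩

@[simp] theorem cf_zero (X Y : Rep t ε) (v) : cf (0 : X ⟶ Y) v = 0 := rfl
@[simp] theorem cf_add {X Y : Rep t ε} (a b : X ⟶ Y) (v) : cf (a + b) v = cf a v + cf b v := rfl
@[simp] theorem cf_neg {X Y : Rep t ε} (a : X ⟶ Y) (v) : cf (-a) v = - cf a v := rfl
@[simp] theorem cf_smul {X Y : Rep t ε} (c : ℂ) (a : X ⟶ Y) (v) : cf (c • a) v = c • cf a v := rfl

instance (X Y : Rep t ε) : AddCommGroup (X ⟶ Y) where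
  add_assoc a b c := hom_ext' fun v => by simp [add_assoc]
  zero_add a := hom_ext' fun v => by simp
  add_zero a := hom_ext' fun v => by simp
  add_comm a b := hom_ext' fun v => by simp [add_comm]
  neg_add_cancel a := hom_ext' fun v => by simp
  nsmul := nsmulRec
  zsmul := zsmulRec

instance preaddRep : Preadditive (Rep t ε) where
  add_comp _ _ _ a b c := hom_ext' fun v => by simp [Matrix.mul_add]
  comp_add _ _ _ a b c := hom_ext' fun v => by simp [Matrix.add_mul]

instance (X Y : Rep t ε) : Module ℂ (X ⟶ Y) where
  one_smul a := hom_ext' fun v => by simp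
  mul_smul a b c := hom_ext' fun v => by simp [mul_smul]
  smul_zero a := hom_ext' fun v => by simp
  smul_add a b c := hom_ext' fun v => by simp
  add_smul a b c := hom_ext' fun v => by simp [add_smul]
  zero_smul a := hom_ext' fun v => by simp

instance linRep : Linear ℂ (Rep t ε) where
  smul_comp _ _ _ a b c := hom_ext' fun v => by simp
  comp_smul _ _ _ a b c := hom_ext' fun v => by simp

/-- The components as a linear map. -/
def cfLin (X Y : Rep t ε) : (X ⟶ Y) →ₗ[ℂ] (∀ v, Matrix (Fin (Y.d v)) (Fin (X.d v)) ℂ) where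
  toFun a v := cf a v
  map_add' _ _ := rfl
  map_smul' _ _ := rfl

instance finHom (X Y : Rep t ε) : Module.Finite ℂ (X ⟶ Y) :=
  Module.Finite.of_injective (cfLin X Y) (fun a b h => hom_ext' fun v => congrFun h v)

theorem iso_iff {X Y : Rep t ε} : Iso X Y ↔ Nonempty (X ≅ Y) := by
  constructor
  · rintro ⟨S, T, h1, h2, h3⟩
    refine ⟨⟨mkHom S fun i => ?_, mkHom T fun i => ?_, ?_, ?_⟩⟩
    · rw [h3, Matrix.mul_assoc, h2, Matrix.mul_one]
    · rw [h3, ← Matrix.mul_assoc, ← Matrix.mul_assoc, h2, Matrix.one_mul]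
    · exact hom_ext' fun v => by simp [h2]
    · exact hom_ext' fun v => by simp [h1]
  · rintro ⟨e⟩
    have h1 : ∀ v, cf e.hom v * cf e.inv v = 1 := fun v => by rw [← cf_comp]; simp
    have h2 : ∀ v, cf e.inv v * cf e.hom v = 1 := fun v => by rw [← cf_comp]; simp
    refine ⟨cf e.hom, cf e.inv, h1, h2, fun i => ?_⟩
    rw [cf_comm, Matrix.mul_assoc, h1, Matrix.mul_one]

theorem Iso.refl (X : Rep t ε) : Iso X X := iso_iff.2 ⟨CategoryTheory.Iso.refl X⟩
theorem Iso.symm {X Y : Rep t ε} (h : Iso X Y) : Iso Y X := by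
  obtain ⟨e⟩ := iso_iff.1 h
  exact iso_iff.2 ⟨e.symm⟩
theorem Iso.trans {X Y Z : Rep t ε} (h : Iso X Y) (h' : Iso Y Z) : Iso X Z := by
  obtain ⟨e⟩ := iso_iff.1 h
  obtain ⟨e'⟩ := iso_iff.1 h'
  exact iso_iff.2 ⟨e ≪≫ e'⟩

/-- Matrices of the embeddings and projections of a direct sum. -/
noncomputable def mInl (m n : ℕ) : Matrix (Fin (m + n)) (Fin m) ℂ :=
  Matrix.reindex finSumFinEquiv (Equiv.refl _) (Matrix.fromRows 1 0)
noncomputable def mInr (m n : ℕ) : Matrix (Fin (m + n)) (Fin n) ℂ :=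
  Matrix.reindex finSumFinEquiv (Equiv.refl _) (Matrix.fromRows 0 1)
noncomputable def mFst (m n : ℕ) : Matrix (Fin m) (Fin (m + n)) ℂ :=
  Matrix.reindex (Equiv.refl _) finSumFinEquiv (Matrix.fromCols 1 0)
noncomputable def mSnd (m n : ℕ) : Matrix (Fin n) (Fin (m + n)) ℂ :=
  Matrix.reindex (Equiv.refl _) finSumFinEquiv (Matrix.fromCols 0 1)

theorem block_eq {m n m' n' : ℕ} (A : Matrix (Fin m) (Fin m') ℂ) (B : Matrix (Fin n) (Fin n') ℂ) :
    Matrix.reindex finSumFinEquiv finSumFinEquiv (Matrix.fromBlocks A 0 0 B) =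
    mInl m n * A * mFst m' n' + mInr m n * B * mSnd m' n' := by
  ext a b
  obtain ⟨a, rfl⟩ := finSumFinEquiv.surjective a
  obtain ⟨b, rfl⟩ := finSumFinEquiv.surjective b
  simp only [mInl, mInr, mFst, mSnd, Matrix.add_apply, Matrix.mul_apply,
    Matrix.reindex_apply, Matrix.submatrix_apply, Equiv.symm_apply_apply]
  rcases a with a | a <;> rcases b with b | b <;> simp [Matrix.one_apply]

theorem dsum_A (X Y : Rep t ε) (i) : (dsum X Y).A i =
    (mInl (X.d (tgt ε i)) (Y.d (tgt ε i)) * X.A i * mFst (X.d (src ε i)) (Y.d (src ε i)) +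
    mInr (X.d (tgt ε i)) (Y.d (tgt ε i)) * Y.A i * mSnd (X.d (src ε i)) (Y.d (src ε i)) :
    Matrix (Fin (X.d (tgt ε i) + Y.d (tgt ε i))) (Fin (X.d (src ε i) + Y.d (src ε i))) ℂ) :=
  block_eq _ _

theorem mFst_mInl (m n : ℕ) : mFst m n * mInl m n = 1 := by
  simp [mFst, mInl, Matrix.fromCols_mul_fromRows]
theorem mSnd_mInr (m n : ℕ) : mSnd m n * mInr m n = 1 := by
  simp [mSnd, mInr, Matrix.fromCols_mul_fromRows]
theorem mFst_mInr (m n : ℕ) : mFst m n * mInr m n = 0 := by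
  simp [mFst, mInr, Matrix.fromCols_mul_fromRows]
theorem mSnd_mInl (m n : ℕ) : mSnd m n * mInl m n = 0 := by
  simp [mSnd, mInl, Matrix.fromCols_mul_fromRows]
theorem m_total (m n : ℕ) : mInl m n * mFst m n + mInr m n * mSnd m n = 1 := by
  ext a b
  obtain ⟨a, rfl⟩ := finSumFinEquiv.surjective a
  obtain ⟨b, rfl⟩ := finSumFinEquiv.surjective b
  simp only [mInl, mInr, mFst, mSnd, Matrix.add_apply, Matrix.mul_apply,
    Matrix.reindex_apply, Matrix.submatrix_apply, Equiv.symm_apply_apply, Matrix.one_apply,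
    EmbeddingLike.apply_eq_iff_eq]
  rcases a with a | a <;> rcases b with b | b <;> simp [Matrix.one_apply]

section
variable {m n m' n' : ℕ} (A : Matrix (Fin m) (Fin m') ℂ) (B : Matrix (Fin n) (Fin n') ℂ)

theorem m_inl_comm : mInl m n * A =
    (mInl m n * A * mFst m' n' + mInr m n * B * mSnd m' n') * mInl m' n' := by
  simp [Matrix.add_mul, Matrix.mul_assoc, mFst_mInl, mSnd_mInl]

theorem m_inr_comm : mInr m n * B =
    (mInl m n * A * mFst m' n' + mInr m n * B * mSnd m' n') * mInr m' n' := by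
  simp [Matrix.add_mul, Matrix.mul_assoc, mFst_mInr, mSnd_mInr]

theorem m_fst_comm : mFst m n *
    (mInl m n * A * mFst m' n' + mInr m n * B * mSnd m' n') = A * mFst m' n' := by
  simp [Matrix.mul_add, ← Matrix.mul_assoc, mFst_mInl, mFst_mInr]

theorem m_snd_comm : mSnd m n *
    (mInl m n * A * mFst m' n' + mInr m n * B * mSnd m' n') = B * mSnd m' n' := by
  simp [Matrix.mul_add, ← Matrix.mul_assoc, mSnd_mInl, mSnd_mInr]
end

noncomputable def dInl (X Y : Rep t ε) : X ⟶ dsum X Y := mkHom (fun v => mInl _ _) fun i => by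
  rw [dsum_A]; exact m_inl_comm _ _
noncomputable def dInr (X Y : Rep t ε) : Y ⟶ dsum X Y := mkHom (fun v => mInr _ _) fun i => by
  rw [dsum_A]; exact m_inr_comm _ _
noncomputable def dFst (X Y : Rep t ε) : dsum X Y ⟶ X := mkHom (fun v => mFst _ _) fun i => by
  rw [dsum_A]; exact m_fst_comm _ _
noncomputable def dSnd (X Y : Rep t ε) : dsum X Y ⟶ Y := mkHom (fun v => mSnd _ _) fun i => by
  rw [dsum_A]; exact m_snd_comm _ _

/-- The bicone of a direct sum. -/
noncomputable def dBicone (X Y : Rep t ε) : BinaryBicone X Y where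
  pt := dsum X Y
  fst := dFst X Y
  snd := dSnd X Y
  inl := dInl X Y
  inr := dInr X Y
  inl_fst := hom_ext' fun v => mFst_mInl _ _
  inl_snd := hom_ext' fun v => mSnd_mInl _ _
  inr_fst := hom_ext' fun v => mFst_mInr _ _
  inr_snd := hom_ext' fun v => mSnd_mInr _ _

theorem dBicone_total (X Y : Rep t ε) :
    (dBicone X Y).fst ≫ (dBicone X Y).inl + (dBicone X Y).snd ≫ (dBicone X Y).inr =
      𝟙 (dBicone X Y).pt := hom_ext' fun v => m_total _ _

instance hasBB : HasBinaryBiproducts (Rep t ε) :=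
  ⟨fun X Y => hasBinaryBiproduct_of_total (dBicone X Y) (dBicone_total X Y)⟩

noncomputable def dIso (X Y : Rep t ε) : dsum X Y ≅ X ⊞ Y :=
  biprod.uniqueUpToIso X Y (isBinaryBilimitOfTotal (dBicone X Y) (dBicone_total X Y))

theorem dsum_congr {X Y X' Y' : Rep t ε} (h : Iso X X') (h' : Iso Y Y') :
    Iso (dsum X Y) (dsum X' Y') := by
  obtain ⟨e⟩ := iso_iff.1 h
  obtain ⟨e'⟩ := iso_iff.1 h'
  exact iso_iff.2 ⟨dIso _ _ ≪≫ biprod.mapIso e e' ≪≫ (dIso _ _).symm⟩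

theorem dsum_comm (X Y : Rep t ε) : Iso (dsum X Y) (dsum Y X) :=
  iso_iff.2 ⟨dIso _ _ ≪≫ biprod.braiding X Y ≪≫ (dIso _ _).symm⟩

theorem dsum_assoc (X Y Z : Rep t ε) : Iso (dsum (dsum X Y) Z) (dsum X (dsum Y Z)) :=
  iso_iff.2 ⟨dIso _ _ ≪≫ biprod.mapIso (dIso _ _) (CategoryTheory.Iso.refl _) ≪≫
    biprod.associator X Y Z ≪≫
    biprod.mapIso (CategoryTheory.Iso.refl _) (dIso _ _).symm ≪≫ (dIso _ _).symm⟩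

theorem nonzero_iff (X : Rep t ε) : Nonzero X ↔ 𝟙 X ≠ 0 := by
  constructor
  · rintro ⟨v, hv⟩ h
    have := congrArg (fun a => cf a v ⟨0, by omega⟩ ⟨0, by omega⟩) h
    simp at this
  · intro h
    by_contra hn
    simp only [Nonzero, not_exists, not_not] at hn
    refine h (hom_ext' fun v => ?_)
    ext a
    exact absurd a.2 (by simp [hn v])

theorem not_nonzero_iff (X : Rep t ε) : ¬ Nonzero X ↔ IsZero X := by
  rw [nonzero_iff, not_not, IsZero.iff_id_eq_zero]

theorem iso_zero_of_not_nonzero {X : Rep t ε} (h : ¬ Nonzero X) : Iso X (zero t ε) :=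
  iso_iff.2 ⟨((not_nonzero_iff X).1 h).iso ((not_nonzero_iff _).1 (by simp [Nonzero, zero]))⟩

theorem zero_dsum (X : Rep t ε) : Iso (dsum (zero t ε) X) X := by
  have hz : IsZero (zero t ε) := (not_nonzero_iff _).1 (by simp [Nonzero, zero])
  refine iso_iff.2 ⟨dIso _ _ ≪≫ ⟨biprod.snd, biprod.inr, ?_, ?_⟩⟩
  · ext
    · exact hz.eq_of_src _ _
    · exact hz.eq_of_src _ _
    · simp
    · simp
  · simp

/-- Rank factorization of an idempotent matrix. -/
theorem matrix_split {n : ℕ} (e : Matrix (Fin n) (Fin n) ℂ) (he : e * e = e) :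
    ∃ (r : ℕ) (p : Matrix (Fin r) (Fin n) ℂ) (j : Matrix (Fin n) (Fin r) ℂ),
      p * j = 1 ∧ j * p = e := by
  classical
  let E := Matrix.toLin' e
  let b := Module.finBasis ℂ (LinearMap.range E)
  let jl : (Fin _ → ℂ) →ₗ[ℂ] (Fin n → ℂ) := (LinearMap.range E).subtype ∘ₗ b.equivFun.symm.toLinearMap
  let pl : (Fin n → ℂ) →ₗ[ℂ] (Fin _ → ℂ) := b.equivFun.toLinearMap ∘ₗ E.rangeRestrict
  have hE : E ∘ₗ E = E := by rw [← Matrix.toLin'_mul, he]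
  refine ⟨_, LinearMap.toMatrix' pl, LinearMap.toMatrix' jl, ?_, ?_⟩
  · rw [← LinearMap.toMatrix'_comp, ← LinearMap.toMatrix'_id]
    congr 1
    refine LinearMap.ext fun x => ?_
    simp only [pl, jl, LinearMap.comp_apply, LinearEquiv.coe_coe, LinearMap.id_apply]
    have : E.rangeRestrict ((LinearMap.range E).subtype (b.equivFun.symm x)) = b.equivFun.symm x := by
      apply Subtype.ext
      obtain ⟨y, hy⟩ := (b.equivFun.symm x).2
      simp only [LinearMap.codRestrict_apply, Submodule.subtype_apply, LinearMap.rangeRestrict]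
      rw [← hy]
      exact LinearMap.congr_fun hE y
    rw [this]; exact b.equivFun.apply_symm_apply x
  · rw [← LinearMap.toMatrix'_comp, ← LinearMap.toMatrix'_toLin' e]
    congr 1
    refine LinearMap.ext fun x => ?_
    simp [pl, jl, E]

theorem idem_split {X : Rep t ε} (e : X ⟶ X) (he : e ≫ e = e) :
    ∃ (C : Rep t ε) (p : X ⟶ C) (j : C ⟶ X), j ≫ p = 𝟙 C ∧ p ≫ j = e := by
  have h := fun v => matrix_split (cf e v) (by rw [← cf_comp, he])
  choose r p j h1 h2 using h
  let C : Rep t ε := ⟨r, fun i => p (tgt ε i) * X.A i * j (src ε i)⟩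
  refine ⟨C, mkHom p fun i => ?_, mkHom j fun i => ?_, hom_ext' fun v => h1 v, hom_ext' fun v => h2 v⟩
  · simp only [C]
    rw [Matrix.mul_assoc _ (j _), h2, Matrix.mul_assoc, ← cf_comm, ← h2]
    simp only [← Matrix.mul_assoc, h1, Matrix.one_mul]
  · simp only [C]
    rw [← Matrix.mul_assoc, ← Matrix.mul_assoc, h2, cf_comm, ← h2]
    simp only [Matrix.mul_assoc, h1, Matrix.mul_one]

theorem retract_split {X B : Rep t ε} (s : X ⟶ B) (r : B ⟶ X) (h : s ≫ r = 𝟙 X) :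
    ∃ (C : Rep t ε) (p : B ⟶ C) (e : B ≅ X ⊞ C), e.hom = biprod.lift r p ∧ s ≫ p = 0 := by
  obtain ⟨C, p, j, h1, h2⟩ := idem_split (𝟙 B - r ≫ s) (by
    simp [reassoc_of% h])
  have hsp : s ≫ p = 0 := by
    have : s ≫ (p ≫ j) ≫ p = 0 := by
      rw [h2]; simp [reassoc_of% h]
    simpa [h1] using this
  have hjr : j ≫ r = 0 := by
    have : j ≫ (p ≫ j) ≫ r = 0 := by
      rw [h2]; simp [h]
    simpa [reassoc_of% h1] using this
  refine ⟨C, p, ⟨biprod.lift r p, biprod.desc s j, ?_, ?_⟩, rfl, hsp⟩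
  · rw [biprod.lift_desc, h2]; simp
  · ext <;> simp [h, h1, hsp, hjr]

theorem Indecomposable.idem {X : Rep t ε} (hX : Indecomposable X) (e : X ⟶ X) (he : e ≫ e = e) :
    e = 0 ∨ e = 𝟙 X := by
  obtain ⟨C, p, j, h1, h2⟩ := idem_split e he
  obtain ⟨D, q, φ, h3, h4⟩ := retract_split j p h1
  by_cases hC : Nonzero C
  · by_cases hD : Nonzero D
    · exact absurd ⟨C, D, hC, hD, iso_iff.2 ⟨φ ≪≫ (dIso C D).symm⟩⟩ hX.2
    · right
      have hz := (not_nonzero_iff D).1 hD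
      have : (p ≫ j) ≫ φ.hom = φ.hom := by
        rw [h3]; ext
        · simp [h1]
        · exact hz.eq_of_tgt _ _
      rw [← cancel_mono φ.hom, ← h2, this]; simp
  · left
    have hz := (not_nonzero_iff C).1 hC
    rw [← h2, hz.eq_of_tgt p 0]; simp

/-- Fitting's lemma for finite dimensional algebras with trivial idempotents. -/
theorem alg_local {A : Type*} [Ring A] [Algebra ℂ A] [Module.Finite ℂ A]
    (h : ∀ e : A, e * e = e → e = 0 ∨ e = 1) (f : A) : IsUnit f ∨ IsNilpotent f := by
  have hint : IsIntegral ℂ f := Algebra.IsIntegral.isIntegral f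
  have hm := minpoly.ne_zero hint
  obtain ⟨q, hq, hq0⟩ := Polynomial.exists_eq_pow_rootMultiplicity_mul_and_not_dvd _ hm (0 : ℂ)
  set k := (minpoly ℂ f).rootMultiplicity 0
  have hX : (Polynomial.X - Polynomial.C (0 : ℂ)) = Polynomial.X := by simp
  rw [hX] at hq hq0
  have hcop : IsCoprime (Polynomial.X ^ (k + 1)) q :=
    IsCoprime.pow_left ((Polynomial.irreducible_X (R := ℂ)).coprime_iff_not_dvd.2 hq0)
  obtain ⟨a, b, hab⟩ := hcop
  have h0 : Polynomial.aeval f (Polynomial.X ^ (k + 1) * q) = 0 := by 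
    rw [pow_succ', mul_assoc, ← hq, map_mul, minpoly.aeval, mul_zero]
  have he : Polynomial.aeval f (b * q) * Polynomial.aeval f (b * q) = Polynomial.aeval f (b * q) := by
    rw [← map_mul]
    have : b * q * (b * q) = b * q - a * b * (Polynomial.X ^ (k + 1) * q) := by
      linear_combination (b * q) * hab
    rw [this, map_sub, map_mul _ (a * b), h0]; simp
  rcases h _ he with h1 | h1
  · left
    have h2 : Polynomial.aeval f (a * Polynomial.X ^ (k + 1)) = 1 := by
      have := congrArg (Polynomial.aeval f) hab
      rwa [map_add, h1, add_zero, map_one] at this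
    have h3 : Polynomial.aeval f (a * Polynomial.X ^ k) * f = 1 := by
      rw [pow_succ, ← mul_assoc, map_mul, Polynomial.aeval_X] at h2
      exact h2
    have h4 : f * Polynomial.aeval f (a * Polynomial.X ^ k) = 1 := by
      rw [pow_succ, ← mul_assoc, mul_comm, map_mul, Polynomial.aeval_X] at h2
      exact h2
    exact ⟨⟨f, _, h4, h3⟩, rfl⟩
  · right
    refine ⟨k + 1, ?_⟩
    have : Polynomial.aeval f (Polynomial.X ^ (k + 1) : Polynomial ℂ) * Polynomial.aeval f (b * q) = 0 := by
      rw [← map_mul, mul_left_comm, map_mul, h0, mul_zero]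
    rw [h1, mul_one] at this
    simpa using this

theorem Indecomposable.local_end {X : Rep t ε} (hX : Indecomposable X) {f g : X ⟶ X}
    (h : f + g = 𝟙 X) : IsIso f ∨ IsIso g := by
  have : Module.Finite ℂ (End X) := finHom X X
  have key := alg_local (A := End X) (fun e he => hX.idem e he) f
  rcases key with h1 | h1
  · exact Or.inl ((isUnit_iff_isIso (f : End X)).1 h1)
  · right
    refine (isUnit_iff_isIso (g : End X)).1 ?_
    have hg : g = 𝟙 X - f := by rw [← h]; simp
    have h2 : IsUnit ((1 : End X) - (show End X from f)) := IsNilpotent.isUnit_one_sub h1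
    rw [hg]
    exact h2

/-! ### Regular representations -/

theorem dim_of_inv {m n : ℕ} {A : Matrix (Fin m) (Fin n) ℂ} {B : Matrix (Fin n) (Fin m) ℂ}
    (h1 : A * B = 1) (h2 : B * A = 1) : m = n := by
  have := (Matrix.toLin'OfInv h1 h2).finrank_eq
  simpa using this

theorem regular_of {X : Rep t ε} (h : ∀ i : Fin t,
    ∃ B : Matrix (Fin (X.d (src ε i))) (Fin (X.d (tgt ε i))) ℂ,
    X.A i * B = 1 ∧ B * X.A i = 1) : Regular X := by
  refine ⟨?_, h⟩
  have hn : ∀ i : Fin t, X.d (next i) = X.d i := by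
    intro i
    obtain ⟨B, h1, h2⟩ := h i
    have := dim_of_inv h1 h2
    by_cases he : ε i = true
    · simpa [tgt, src, he] using this
    · simpa [tgt, src, he] using this.symm
  have h0 : ∀ (k : ℕ) (hk : k < t), X.d ⟨k, hk⟩ = X.d ⟨0, by omega⟩ := by
    intro k
    induction k with
    | zero => intro _; rfl
    | succ k ih =>
      intro hk
      rw [← ih (by omega), ← hn ⟨k, by omega⟩]
      congr 1
      simp [next, Nat.mod_eq_of_lt hk]
  intro v w
  rw [h0 v.1 v.2, h0 w.1 w.2]

theorem Regular.retract {X Y : Rep t ε} (hX : Regular X) (s : Y ⟶ X) (r : X ⟶ Y)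
    (h : s ≫ r = 𝟙 Y) : Regular Y := by
  refine regular_of fun i => ?_
  obtain ⟨B, h1, h2⟩ := hX.2 i
  have hc : ∀ v, cf r v * cf s v = 1 := fun v => by rw [← cf_comp, h, cf_id]
  refine ⟨cf r (src ε i) * B * cf s (tgt ε i), ?_, ?_⟩
  · rw [← Matrix.mul_assoc, ← Matrix.mul_assoc, ← cf_comm, Matrix.mul_assoc _ (X.A i), h1,
      Matrix.mul_one, hc]
  · rw [Matrix.mul_assoc, cf_comm, Matrix.mul_assoc, ← Matrix.mul_assoc B, h2,
      Matrix.one_mul, hc]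

theorem Regular.of_iso {X Y : Rep t ε} (hX : Regular X) (h : Iso X Y) : Regular Y := by
  obtain ⟨e⟩ := iso_iff.1 h
  exact hX.retract e.inv e.hom e.inv_hom_id

theorem Regular.dsum_left {X Y : Rep t ε} (h : Regular (dsum X Y)) : Regular X :=
  h.retract (dInl X Y) (dFst X Y) (dBicone X Y).inl_fst

theorem Regular.dsum_right {X Y : Rep t ε} (h : Regular (dsum X Y)) : Regular Y :=
  h.retract (dInr X Y) (dSnd X Y) (dBicone X Y).inr_snd

theorem Regular.dsum {X Y : Rep t ε} (hX : Regular X) (hY : Regular Y) :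
    Regular (CycleQuiver.dsum X Y) := by
  refine regular_of fun i => ?_
  obtain ⟨B, h1, h2⟩ := hX.2 i
  obtain ⟨C, h3, h4⟩ := hY.2 i
  refine ⟨Matrix.reindex finSumFinEquiv finSumFinEquiv (Matrix.fromBlocks B 0 0 C), ?_, ?_⟩
  · change Matrix.reindex finSumFinEquiv finSumFinEquiv (Matrix.fromBlocks (X.A i) 0 0 (Y.A i)) *
      Matrix.reindex finSumFinEquiv finSumFinEquiv (Matrix.fromBlocks B 0 0 C) = 1
    simp [Matrix.submatrix_mul_equiv, Matrix.fromBlocks_multiply, h1, h3]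
  · change Matrix.reindex finSumFinEquiv finSumFinEquiv (Matrix.fromBlocks B 0 0 C) *
      Matrix.reindex finSumFinEquiv finSumFinEquiv (Matrix.fromBlocks (X.A i) 0 0 (Y.A i)) = 1
    simp [Matrix.submatrix_mul_equiv, Matrix.fromBlocks_multiply, h2, h4]

theorem regular_zero : Regular (zero t ε) :=
  ⟨fun _ _ => rfl, fun _ => ⟨0, by ext a; exact a.elim0, by ext a; exact a.elim0⟩⟩

theorem regular_dsumList {L : List (Rep t ε)} (h : ∀ D ∈ L, Regular D) :
    Regular (dsumList L) := by
  induction L with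
  | nil => exact regular_zero
  | cons X L ih =>
    exact (h X (by simp)).dsum (ih fun D hD => h D (by simp [hD]))

theorem regular_of_dsumList {L : List (Rep t ε)} (h : Regular (dsumList L)) :
    ∀ D ∈ L, Regular D := by
  induction L with
  | nil => simp
  | cons X L ih =>
    have h' : Regular (dsum X (dsumList L)) := h
    intro D hD
    rcases List.mem_cons.1 hD with rfl | hD
    · exact h'.dsum_left
    · exact ih h'.dsum_right D hD

/-! ### Lists -/

theorem dsumList_append (L M : List (Rep t ε)) :
    Iso (dsumList (L ++ M)) (dsum (dsumList L) (dsumList M)) := by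
  induction L with
  | nil => exact (zero_dsum _).symm
  | cons X L ih =>
    exact (dsum_congr (Iso.refl X) ih).trans (dsum_assoc _ _ _).symm

theorem dsumList_perm {L M : List (Rep t ε)} (h : L.Perm M) :
    Iso (dsumList L) (dsumList M) := by
  induction h with
  | nil => exact Iso.refl _
  | cons X _ ih => exact dsum_congr (Iso.refl X) ih
  | swap X Y L =>
    exact (dsum_assoc Y X _).symm.trans
      ((dsum_congr (dsum_comm Y X) (Iso.refl _)).trans (dsum_assoc X Y _))
  | trans _ _ h1 h2 => exact h1.trans h2

theorem Iso.d_eq {X Y : Rep t ε} (h : Iso X Y) (v) : Y.d v = X.d v := by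
  obtain ⟨S, T, h1, h2, -⟩ := h
  exact dim_of_inv (h1 v) (h2 v)

theorem exists_indec (n : ℕ) : ∀ X : Rep t ε, ∑ v, X.d v = n →
    ∃ L : List (Rep t ε), (∀ D ∈ L, Indecomposable D) ∧ Iso X (dsumList L) := by
  induction n using Nat.strong_induction_on with
  | _ n ih =>
    intro X hX
    by_cases h0 : Nonzero X
    · by_cases hi : Indecomposable X
      · exact ⟨[X], by simpa using hi, (zero_dsum X).symm.trans (dsum_comm _ _)⟩
      · simp only [Indecomposable, not_and, not_not] at hi
        obtain ⟨Y, Z, hY, hZ, h⟩ := hi h0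
        have hd : ∑ v, X.d v = ∑ v, Y.d v + ∑ v, Z.d v := by
          rw [← Finset.sum_add_distrib]
          exact Finset.sum_congr rfl fun v _ => (h.d_eq v).symm
        have hpos : ∀ W : Rep t ε, Nonzero W → 0 < ∑ v, W.d v := by
          rintro W ⟨v, hv⟩
          exact Finset.sum_pos' (fun _ _ => Nat.zero_le _) ⟨v, Finset.mem_univ _, by omega⟩
        have h1 := hpos Y hY
        have h2 := hpos Z hZ
        obtain ⟨L, hL, hL'⟩ := ih _ (by omega) Y rfl
        obtain ⟨M, hM, hM'⟩ := ih _ (by omega) Z rfl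
        refine ⟨L ++ M, fun D hD => ?_, h.trans ((dsum_congr hL' hM').trans
          (dsumList_append L M).symm)⟩
        rcases List.mem_append.1 hD with hD | hD
        · exact hL D hD
        · exact hM D hD
    · exact ⟨[], by simp, iso_zero_of_not_nonzero h0⟩

theorem isZero_zero' : IsZero (zero t ε) := (not_nonzero_iff _).1 (by simp [Nonzero, zero])

/-- The exchange property. -/
theorem exchange {X : Rep t ε} (hX : Indecomposable X) (L : List (Rep t ε)) :
    ∀ (A : Rep t ε), (∀ D ∈ L, Indecomposable D) → Iso (dsum X A) (dsumList L) →
    ∃ (L₁ : List (Rep t ε)) (Y : Rep t ε) (L₂ : List (Rep t ε)),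
      L = L₁ ++ Y :: L₂ ∧ Iso X Y ∧ Iso A (dsumList (L₁ ++ L₂)) := by
  have hX1 : 𝟙 X ≠ 0 := (nonzero_iff X).1 hX.1
  induction L with
  | nil =>
    intro A _ h
    obtain ⟨e⟩ := iso_iff.1 h
    exfalso
    apply hX1
    have h1 : biprod.inl ≫ ((dIso X A).symm ≪≫ e).hom ≫ ((dIso X A).symm ≪≫ e).inv ≫ biprod.fst
        = 𝟙 X := by
      rw [CategoryTheory.Iso.hom_inv_id_assoc]; simp
    have h2 : ((dIso X A).symm ≪≫ e).hom = 0 := isZero_zero'.eq_of_tgt _ _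
    rw [← h1, h2, zero_comp, comp_zero]
  | cons Y L ih =>
    intro A hL h
    have hY : Indecomposable Y := hL Y (by simp)
    obtain ⟨e⟩ := iso_iff.1 h
    let B := dsumList L
    let φ : X ⊞ A ≅ Y ⊞ B := (dIso X A).symm ≪≫ e ≪≫ dIso Y B
    let f₁ : X ⟶ Y := biprod.inl ≫ φ.hom ≫ biprod.fst
    let f₂ : X ⟶ B := biprod.inl ≫ φ.hom ≫ biprod.snd
    let g₁ : Y ⟶ X := biprod.inl ≫ φ.inv ≫ biprod.fst
    let g₂ : B ⟶ X := biprod.inr ≫ φ.inv ≫ biprod.fst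
    have hsum : f₁ ≫ g₁ + f₂ ≫ g₂ = 𝟙 X := by
      have h1 : f₁ ≫ g₁ + f₂ ≫ g₂ = biprod.inl ≫ φ.hom ≫
          (biprod.fst ≫ biprod.inl + biprod.snd ≫ biprod.inr) ≫ φ.inv ≫ biprod.fst := by
        simp only [f₁, g₁, f₂, g₂, Preadditive.add_comp, Preadditive.comp_add, Category.assoc]
      rw [h1, biprod.total, Category.id_comp, CategoryTheory.Iso.hom_inv_id_assoc,
        biprod.inl_fst]
    rcases hX.local_end hsum with hi | hi
    · have hr : f₁ ≫ (g₁ ≫ inv (f₁ ≫ g₁)) = 𝟙 X := by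
        rw [← Category.assoc]; exact IsIso.hom_inv_id _
      generalize (g₁ ≫ inv (f₁ ≫ g₁)) = r at hr
      have hri : r ≫ f₁ = 𝟙 Y := by
        rcases hY.idem (r ≫ f₁) (by simp [reassoc_of% hr]) with h0 | h0
        · exfalso
          apply hX1
          have : f₁ ≫ (r ≫ f₁) ≫ r = 𝟙 X := by simp [hr]
          rw [← this, h0]; simp
        · exact h0
      have : IsIso (biprod.inl ≫ φ.hom ≫ biprod.fst) := ⟨r, hr, hri⟩
      have hA : A ≅ B := Biprod.isoElim φ
      exact ⟨[], Y, L, rfl, iso_iff.2 ⟨⟨f₁, r, hr, hri⟩⟩, iso_iff.2 ⟨hA⟩⟩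
    · have hr : f₂ ≫ (g₂ ≫ inv (f₂ ≫ g₂)) = 𝟙 X := by
        rw [← Category.assoc]; exact IsIso.hom_inv_id _
      generalize (g₂ ≫ inv (f₂ ≫ g₂)) = r at hr
      obtain ⟨C, p, ψ, hψ, -⟩ := retract_split f₂ r hr
      obtain ⟨L₁, Z, L₂, rfl, hZ, hC⟩ := ih C (fun D hD => hL D (by simp [hD]))
        (iso_iff.2 ⟨dIso X C ≪≫ ψ.symm⟩)
      refine ⟨Y :: L₁, Z, L₂, rfl, hZ, ?_⟩
      let χ : X ⊞ A ≅ X ⊞ (C ⊞ Y) := φ ≪≫ biprod.braiding Y B ≪≫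
        biprod.mapIso ψ (CategoryTheory.Iso.refl Y) ≪≫ biprod.associator X C Y
      have hχ : biprod.inl ≫ χ.hom ≫ biprod.fst = 𝟙 X := by
        rw [← hr]
        simp [χ, hψ, f₂]
      have : IsIso (biprod.inl ≫ χ.hom ≫ biprod.fst) := by rw [hχ]; infer_instance
      have hA : Iso A (dsum C Y) := iso_iff.2 ⟨Biprod.isoElim χ ≪≫ (dIso C Y).symm⟩
      exact hA.trans ((dsum_comm C Y).trans (dsum_congr (Iso.refl Y) hC))

/-- Isomorphism as a setoid. -/
def isoSetoid (t : ℕ) (ε : Fin t → Bool) : Setoid (Rep t ε) :=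
  ⟨Iso, ⟨Iso.refl, Iso.symm, Iso.trans⟩⟩

/-- Isomorphism class. -/
def cls (X : Rep t ε) : Quotient (isoSetoid t ε) := Quotient.mk _ X

theorem cls_eq {X Y : Rep t ε} : cls X = cls Y ↔ Iso X Y :=
  ⟨fun h => Quotient.exact (s := isoSetoid t ε) h, fun h => Quotient.sound (s := isoSetoid t ε) h⟩

/-- Krull-Schmidt. -/
theorem krull_schmidt (L : List (Rep t ε)) : ∀ L' : List (Rep t ε),
    (∀ D ∈ L, Indecomposable D) → (∀ D ∈ L', Indecomposable D) →
    Iso (dsumList L) (dsumList L') → (L.map cls).Perm (L'.map cls) := by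
  induction L with
  | nil =>
    intro L' _ hL' h
    rcases L' with _ | ⟨Y, L'⟩
    · simp
    · exfalso
      obtain ⟨v, hv⟩ := (hL' Y (by simp)).1
      have : Y.d v + (dsumList L').d v = 0 := h.d_eq v
      omega
  | cons X L ih =>
    intro L' hL hL' h
    obtain ⟨L₁, Y, L₂, rfl, hY, hA⟩ := exchange (hL X (by simp)) L' (dsumList L) hL' h
    have := ih (L₁ ++ L₂) (fun D hD => hL D (by simp [hD]))
      (fun D hD => hL' D (by
        rcases List.mem_append.1 hD with hD | hD <;> simp [hD])) hA
    simp only [List.map_append, List.map_cons] at this ⊢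
    rw [cls_eq.2 hY]
    exact (List.Perm.cons _ this).trans List.perm_middle.symm

theorem dsumList_of_cls_eq : ∀ {L M : List (Rep t ε)}, L.map cls = M.map cls →
    Iso (dsumList L) (dsumList M)
  | [], [], _ => Iso.refl _
  | [], _ :: _, h => by simp at h
  | _ :: _, [], h => by simp at h
  | X :: L, Y :: M, h => by
    simp only [List.map_cons, List.cons.injEq] at h
    exact dsum_congr (cls_eq.1 h.1) (dsumList_of_cls_eq h.2)

theorem dsumList_of_cls_perm {L M : List (Rep t ε)} (h : (L.map cls).Perm (M.map cls)) :
    Iso (dsumList L) (dsumList M) := by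
  have h' : Relation.Comp (fun a (b : List (Rep t ε)) => a = List.map cls b) List.Perm (L.map cls) M := by
    rw [List.eq_map_comp_perm]; exact h
  obtain ⟨N, h1, h2⟩ := h'
  exact (dsumList_of_cls_eq h1).trans (dsumList_perm h2)

theorem exists_equiv_of_cls_perm {L M : List (Rep t ε)} (h : (L.map cls).Perm (M.map cls)) :
    ∃ σ : Fin L.length ≃ Fin M.length, ∀ k, Iso (L.get k) (M.get (σ k)) := by
  classical
  have hl : ∀ N : List (Rep t ε), N.length = (N.map cls).length := fun N => by simp
  let τ : Fin (L.map cls).length ≃ Fin (M.map cls).length :=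
    ⟨h.idxBij, h.symm.idxBij, h.idxBij_rightInverse_idxBij_symm,
      h.idxBij_leftInverse_idxBij_symm⟩
  refine ⟨(finCongr (hl L)).trans (τ.trans (finCongr (hl M).symm)), fun k => ?_⟩
  have := h.getElem_idxBij_eq_getElem (finCongr (hl L) k)
  rw [List.getElem_map, List.getElem_map] at this
  exact (cls_eq.1 this).symm

/-- Separating singular and regular classes. -/
theorem perm_separate {L M L' M' : List (Rep t ε)} (hL : ∀ D ∈ L, Singular D)
    (hM : ∀ D ∈ M, Regular D) (hL' : ∀ D ∈ L', Singular D) (hM' : ∀ D ∈ M', Regular D)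
    (h : ((L ++ M).map cls).Perm ((L' ++ M').map cls)) :
    (L.map cls).Perm (L'.map cls) ∧ (M.map cls).Perm (M'.map cls) := by
  classical
  let p : Quotient (isoSetoid t ε) → Bool := fun c => decide (∃ X : Rep t ε, cls X = c ∧ Regular X)
  have hp : ∀ X : Rep t ε, p (cls X) = true ↔ Regular X := by
    intro X
    simp only [p, decide_eq_true_eq]
    exact ⟨fun ⟨Y, h1, h2⟩ => h2.of_iso (cls_eq.1 h1), fun h => ⟨X, rfl, h⟩⟩
  have key : ∀ L M : List (Rep t ε), (∀ D ∈ L, Singular D) → (∀ D ∈ M, Regular D) →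
      ((L ++ M).map cls).filter p = M.map cls ∧
      ((L ++ M).map cls).filter (fun c => !p c) = L.map cls := by
    intro L M hL hM
    rw [List.map_append, List.filter_append, List.filter_append]
    have a1 : (L.map cls).filter p = [] := by
      simp only [List.filter_eq_nil_iff, List.mem_map]
      rintro _ ⟨D, hD, rfl⟩ h
      exact hL D hD ((hp D).1 h)
    have a2 : (M.map cls).filter p = M.map cls := by
      simp only [List.filter_eq_self, List.mem_map]
      rintro _ ⟨D, hD, rfl⟩
      exact (hp D).2 (hM D hD)
    have a3 : (L.map cls).filter (fun c => !p c) = L.map cls := by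
      simp only [List.filter_eq_self, List.mem_map]
      rintro _ ⟨D, hD, rfl⟩
      have := mt (hp D).1 (hL D hD)
      simpa using this
    have a4 : (M.map cls).filter (fun c => !p c) = [] := by
      simp only [List.filter_eq_nil_iff, List.mem_map]
      rintro _ ⟨D, hD, rfl⟩ h
      have := (hp D).2 (hM D hD)
      simp [this] at h
    simp [a1, a2, a3, a4]
  obtain ⟨b1, b2⟩ := key L M hL hM
  obtain ⟨c1, c2⟩ := key L' M' hL' hM'
  constructor
  · rw [← b2, ← c2]; exact h.filter _
  · rw [← b1, ← c1]; exact h.filter _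

end Helpers

end CycleQuiver

namespace CycleQuiver

/-- Regularizing decomposition (Theorem of the paper): every matrix representation of
the cycle quiver (`t ≥ 2`, arbitrary orientation) is isomorphic to a direct sum
`𝔻₁ ⊕ … ⊕ 𝔻_k ⊕ ℙ` with each `𝔻_m` indecomposable and singular and `ℙ` regular;
moreover the multiset of isomorphism classes of the `𝔻_m` and the isomorphism class
of `ℙ` are uniquely determined. -/
theorem cycle_regularizing_decomposition (t : ℕ) (ht : 2 ≤ t) (ε : Fin t → Bool)
    (X : Rep t ε) :
    ∃ (L : List (Rep t ε)) (P : Rep t ε),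
      (∀ D ∈ L, Indecomposable D ∧ Singular D) ∧ Regular P ∧
      Iso X (dsum (dsumList L) P) ∧
      ∀ (L' : List (Rep t ε)) (P' : Rep t ε),
        (∀ D ∈ L', Indecomposable D ∧ Singular D) → Regular P' →
        Iso X (dsum (dsumList L') P') →
        (∃ σ : Fin L.length ≃ Fin L'.length, ∀ k, Iso (L.get k) (L'.get (σ k))) ∧
        Iso P P' := by
  classical
  obtain ⟨N, hN, hXN⟩ := exists_indec _ X rfl
  let L := N.filter (fun D => decide (Singular D))
  let M := N.filter (fun D => !decide (Singular D))
  have hL : ∀ D ∈ L, Indecomposable D ∧ Singular D := fun D hD => by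
    simp only [L, List.mem_filter, decide_eq_true_eq] at hD
    exact ⟨hN D hD.1, hD.2⟩
  have hM : ∀ D ∈ M, Indecomposable D ∧ Regular D := fun D hD => by
    simp only [M, List.mem_filter, Bool.not_eq_true', decide_eq_false_iff_not] at hD
    exact ⟨hN D hD.1, not_not.1 hD.2⟩
  have hX : Iso X (dsumList (L ++ M)) :=
    hXN.trans (dsumList_perm (List.filter_append_perm _ N).symm)
  refine ⟨L, dsumList M, hL, regular_dsumList fun D hD => (hM D hD).2,
    hX.trans (dsumList_append L M), ?_⟩
  intro L' P' hL' hP' hX'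
  obtain ⟨M', hM', hPM'⟩ := exists_indec _ P' rfl
  have hM'r := regular_of_dsumList (hP'.of_iso hPM')
  have hX2 : Iso X (dsumList (L' ++ M')) :=
    hX'.trans ((dsum_congr (Iso.refl _) hPM').trans (dsumList_append L' M').symm)
  have hks := krull_schmidt (L ++ M) (L' ++ M')
    (fun D hD => (List.mem_append.1 hD).elim (fun h => (hL D h).1) (fun h => (hM D h).1))
    (fun D hD => (List.mem_append.1 hD).elim (fun h => (hL' D h).1) (fun h => hM' D h))
    (hX.symm.trans hX2)
  obtain ⟨h1, h2⟩ := perm_separate (fun D hD => (hL D hD).2) (fun D hD => (hM D hD).2)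
    (fun D hD => (hL' D hD).2) hM'r hks
  exact ⟨exists_equiv_of_cls_perm h1, (dsumList_of_cls_perm h2).trans hPM'.symm⟩

end CycleQuiver
end

section
/- Every pair (A,B) of p×q complex matrices is simultaneously equivalent to a direct sum (A₁,B₁) ⊕ … ⊕ (A_r,B_r) ⊕ (C,D), where each pair (A_i,B_i) has one of the forms (I_n, J_n(0)), (J_n(0), I_n), (F_n, G_n), (F_nᵀ, G_nᵀ), and C and D are square invertible matrices of equal size. -/
open Matrix

/-- A pair of `p × q` complex matrices (sizes are part of the data). -/
structure MatrixPair where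
  p : ℕ
  q : ℕ
  A : Matrix (Fin p) (Fin q) ℂ
  B : Matrix (Fin p) (Fin q) ℂ

namespace MatrixPair

/-- Block-diagonal direct sum of pairs: `(A,B) ⊕ (C,D) = (A ⊕ C, B ⊕ D)`. -/
noncomputable def dsum (P Q : MatrixPair) : MatrixPair :=
  ⟨P.p + Q.p, P.q + Q.q,
    Matrix.reindex finSumFinEquiv finSumFinEquiv (Matrix.fromBlocks P.A 0 0 Q.A),
    Matrix.reindex finSumFinEquiv finSumFinEquiv (Matrix.fromBlocks P.B 0 0 Q.B)⟩

/-- The empty (0×0) pair. -/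
def zero : MatrixPair := ⟨0, 0, 0, 0⟩

/-- Direct sum of a list of pairs. -/
noncomputable def dsumList (L : List MatrixPair) : MatrixPair := L.foldr dsum zero

/-- Simultaneous equivalence: `Q = (R⁻¹ P.A S, R⁻¹ P.B S)` for invertible `R`, `S`. -/
def SimEquiv (P Q : MatrixPair) : Prop :=
  ∃ (R : Matrix (Fin Q.p) (Fin P.p) ℂ) (R' : Matrix (Fin P.p) (Fin Q.p) ℂ)
    (S : Matrix (Fin P.q) (Fin Q.q) ℂ) (S' : Matrix (Fin Q.q) (Fin P.q) ℂ),
    R * R' = 1 ∧ R' * R = 1 ∧ S * S' = 1 ∧ S' * S = 1 ∧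
    Q.A = R * P.A * S ∧ Q.B = R * P.B * S

end MatrixPair

/-- The `n × n` Jordan block `J_n(λ)`. -/
noncomputable def Jmat (n : ℕ) (l : ℂ) : Matrix (Fin n) (Fin n) ℂ :=
  Matrix.of fun i j => if (j : ℕ) = (i : ℕ) then l else if (j : ℕ) = (i : ℕ) + 1 then 1 else 0

/-- The `(n-1) × n` matrix `F_n`. -/
noncomputable def Fmat (n : ℕ) : Matrix (Fin (n - 1)) (Fin n) ℂ :=
  Matrix.of fun i j => if (j : ℕ) = (i : ℕ) then 1 else 0

/-- The `(n-1) × n` matrix `G_n`. -/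
noncomputable def Gmat (n : ℕ) : Matrix (Fin (n - 1)) (Fin n) ℂ :=
  Matrix.of fun i j => if (j : ℕ) = (i : ℕ) + 1 then 1 else 0

/-- Singular (irregular) canonical Kronecker pairs:
`(I_n, J_n(0))`, `(J_n(0), I_n)`, `(F_n, G_n)`, `(F_nᵀ, G_nᵀ)`. -/
noncomputable def SingularKroneckerCanonical (P : MatrixPair) : Prop :=
  ∃ n : ℕ, 1 ≤ n ∧
    (P = ⟨n, n, 1, Jmat n 0⟩ ∨
      P = ⟨n, n, Jmat n 0, 1⟩ ∨
      P = ⟨n - 1, n, Fmat n, Gmat n⟩ ∨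
      P = ⟨n, n - 1, (Fmat n)ᵀ, (Gmat n)ᵀ⟩)

/-- Common data of a chain starting in the kernel of `A`. -/
structure KChain {V W : Type} [AddCommGroup V] [Module ℂ V] [AddCommGroup W] [Module ℂ W]
    (A B : V →ₗ[ℂ] W) (m : ℕ) (u : ℕ → V) (f : ℕ → V →ₗ[ℂ] ℂ) (g : ℕ → W →ₗ[ℂ] ℂ) : Prop where
  a0 : A (u 0) = 0
  step : ∀ i < m, A (u (i + 1)) = B (u i)
  gA : ∀ i < m, ∀ x, g i (A x) = f (i + 1) x
  gB : ∀ i < m, ∀ x, g i (B x) = f i x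
  dual : ∀ i ≤ m, ∀ j ≤ m, f i (u j) = if i = j then 1 else 0
  last : B (u m) = 0 ∨ ((∀ x, g m (B x) = f m x) ∧ ∀ x, g m (A x) = 0)

theorem exists_factor {V W : Type} [AddCommGroup V] [Module ℂ V] [AddCommGroup W] [Module ℂ W]
    (A : V →ₗ[ℂ] W) (f : V →ₗ[ℂ] ℂ) (h : ∀ x, A x = 0 → f x = 0) :
    ∃ g : W →ₗ[ℂ] ℂ, ∀ x, g (A x) = f x := by
  have : f ∈ LinearMap.range A.dualMap := by
    rw [LinearMap.range_dualMap_eq_dualAnnihilator_ker, Submodule.mem_dualAnnihilator]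
    intro w hw
    exact h w hw
  obtain ⟨g, hg⟩ := this
  exact ⟨g, fun x => by rw [← hg]; rfl⟩

theorem exists_chain : ∀ (n : ℕ) (V W : Type) [AddCommGroup V] [Module ℂ V] [AddCommGroup W]
    [Module ℂ W] [FiniteDimensional ℂ V] (A B : V →ₗ[ℂ] W),
    Module.finrank ℂ V = n → LinearMap.ker A ≠ ⊥ → ∃ m u f g, KChain A B m u f g := by
  intro n
  induction n using Nat.strong_induction_on with
  | _ n ih =>
  intro V W _ _ _ _ _ A B hn hker
  by_cases hAB : ∃ x, A x = 0 ∧ B x = 0 ∧ x ≠ 0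
  · obtain ⟨x, hA, hB, hx⟩ := hAB
    have hnot : x ∉ (⊥ : Submodule ℂ V) := by simpa using hx
    obtain ⟨f, hf, -⟩ := Submodule.exists_le_ker_of_notMem hnot
    refine ⟨0, fun _ => x, fun _ => (f x)⁻¹ • f, fun _ => 0, ?_⟩
    refine ⟨hA, by simp, by simp, by simp, ?_, Or.inl hB⟩
    intro i hi j hj
    obtain rfl : i = 0 := by omega
    obtain rfl : j = 0 := by omega
    simp [hf]
  push Not at hAB
  set K := LinearMap.ker A with hK
  set U := K.map B with hU
  have hAK : K ≤ U.comap A := by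
    intro x hx
    have : A x = 0 := hx
    simp [this]
  have hBK : K ≤ U.comap B := fun x hx => Submodule.mem_map_of_mem hx
  by_cases hk' : LinearMap.ker (K.mapQ U A hAK) = ⊥
  · -- length one chain of the second kind
    obtain ⟨x, hxK, hx⟩ := Submodule.exists_mem_ne_zero_of_ne_bot hker
    have hxA : A x = 0 := hxK
    have hnot : B x ∉ LinearMap.range A := by
      rintro ⟨y, hy⟩
      have h1 : K.mkQ y ∈ LinearMap.ker (K.mapQ U A hAK) := by
        simp only [LinearMap.mem_ker, Submodule.mkQ_apply, Submodule.mapQ_apply,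
          Submodule.Quotient.mk_eq_zero]
        rw [hy]
        exact Submodule.mem_map_of_mem hxK
      rw [hk', Submodule.mem_bot, Submodule.mkQ_apply, Submodule.Quotient.mk_eq_zero] at h1
      have h2 : A y = 0 := h1
      exact hx (hAB x hxA (by rw [← hy, h2]))
    obtain ⟨g, hg, hg2⟩ := Submodule.exists_le_ker_of_notMem hnot
    refine ⟨0, fun _ => x, fun _ => (g (B x))⁻¹ • g ∘ₗ B, fun _ => (g (B x))⁻¹ • g, ?_⟩
    refine ⟨hxA, by simp, by simp, by simp, ?_, Or.inr ⟨by simp, ?_⟩⟩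
    · intro i hi j hj
      obtain rfl : i = 0 := by omega
      obtain rfl : j = 0 := by omega
      simp [hg]
    · intro y
      have : g (A y) = 0 := hg2 ⟨y, rfl⟩
      simp [this]
  · have hlt : Module.finrank ℂ (V ⧸ K) < n := by
      have h1 := Submodule.finrank_quotient_add_finrank K
      have h2 : 0 < Module.finrank ℂ K := by
        rw [Nat.pos_iff_ne_zero, Ne, Submodule.finrank_eq_zero]
        exact hker
      omega
    obtain ⟨m, u', f', g', hc⟩ := ih _ hlt (V ⧸ K) (W ⧸ U) (K.mapQ U A hAK) (K.mapQ U B hBK) rfl hk'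
    choose x hx using fun i => K.mkQ_surjective (u' i)
    have hx0 : ∃ k ∈ K, A (x 0) = B k := by
      have := hc.a0
      rw [← hx, Submodule.mkQ_apply, Submodule.mapQ_apply, Submodule.Quotient.mk_eq_zero] at this
      obtain ⟨k, hk, h⟩ := this
      exact ⟨k, hk, h.symm⟩
    obtain ⟨k₀, hk₀, hxk₀⟩ := hx0
    have hstep : ∀ i, ∃ k ∈ K, i < m → A (x (i + 1)) = B (x i + k) := by
      intro i
      by_cases hi : i < m
      · have := hc.step i hi
        rw [← hx, ← hx, Submodule.mkQ_apply, Submodule.mkQ_apply, Submodule.mapQ_apply,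
          Submodule.mapQ_apply, Submodule.Quotient.eq] at this
        obtain ⟨k, hk, h⟩ := this
        exact ⟨k, hk, fun _ => by rw [map_add, h]; abel⟩
      · exact ⟨0, K.zero_mem, fun h => absurd h hi⟩
    choose k hkK hk using hstep
    obtain ⟨g₀, hg₀⟩ := exists_factor A (f' 0 ∘ₗ K.mkQ) (by
      intro y hy
      have hy' : y ∈ K := hy
      have : K.mkQ y = 0 := by simpa using hy'
      simp only [LinearMap.comp_apply, this, map_zero])
    have hfK : ∀ i, ∀ y ∈ K, f' i (K.mkQ y) = 0 := by
      intro i y hy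
      have : K.mkQ y = 0 := by simpa using hy
      rw [this, map_zero]
    have hgU : ∀ i, ∀ y ∈ K, g' i (U.mkQ (B y)) = 0 := by
      intro i y hy
      have : U.mkQ (B y) = 0 := by simpa using hBK hy
      rw [this, map_zero]
    have hfu : ∀ i, i ≤ m → ∀ j, j ≤ m → f' i (K.mkQ (x j)) = if i = j then 1 else 0 := by
      intro i hi j hj
      rw [hx]; exact hc.dual i hi j hj
    have hgk : g₀ (B k₀) = 1 := by
      rw [← hxk₀, hg₀, LinearMap.comp_apply, hfu 0 (by omega) 0 (by omega)]; simp
    -- final correction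
    obtain ⟨c, hcK, hcB, hclast⟩ : ∃ c ∈ K, g₀ (B (x m + c)) = 0 ∧
        (B (x m + c) = 0 ∨ ((∀ y, g' m (U.mkQ (B y)) = f' m (K.mkQ y)) ∧
          ∀ y, g' m (U.mkQ (A y)) = 0)) := by
      rcases hc.last with h | ⟨h1, h2⟩
      · rw [← hx, Submodule.mkQ_apply, Submodule.mapQ_apply, Submodule.Quotient.mk_eq_zero] at h
        obtain ⟨c, hcK, hcc⟩ := h
        have : B (x m + -c) = 0 := by rw [map_add, map_neg, hcc]; abel
        exact ⟨-c, K.neg_mem hcK, by rw [this, map_zero], Or.inl this⟩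
      · refine ⟨-(g₀ (B (x m))) • k₀, K.smul_mem _ hk₀, ?_, Or.inr ⟨fun y => h1 (K.mkQ y),
          fun y => h2 (K.mkQ y)⟩⟩
        simp [hgk]
    let d : ℕ → V := fun i => if i < m then k i else c
    have hdK : ∀ i, d i ∈ K := by
      intro i
      by_cases hi : i < m <;> simp [d, hi, hkK, hcK]
    have hdm : d m = c := by simp [d]
    have hdk : ∀ i < m, d i = k i := fun i hi => by simp [d, hi]
    have hAd : ∀ i, A (d i) = 0 := fun i => hdK i
    have hfd : ∀ i, i ≤ m → ∀ j, j ≤ m → f' i (K.mkQ (x j + d j)) = if i = j then 1 else 0 := by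
      intro i hi j hj
      rw [map_add, map_add, hfK i _ (hdK j), add_zero, hfu i hi j hj]
    have hstep' : ∀ i < m, A (x (i + 1) + d (i + 1)) = B (x i + d i) := by
      intro i hi
      rw [map_add, hAd, add_zero, hk i hi, hdk i hi]
    refine ⟨m + 1, fun i => Nat.casesOn i k₀ (fun i => x i + d i),
      fun i => Nat.casesOn i (g₀ ∘ₗ B) (fun i => f' i ∘ₗ K.mkQ),
      fun i => Nat.casesOn i g₀ (fun i => g' i ∘ₗ U.mkQ), ?_⟩
    refine ⟨hk₀, ?_, ?_, ?_, ?_, ?_⟩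
    · rintro (_ | i) hi
      · change A (x 0 + d 0) = B k₀
        rw [map_add, hAd, add_zero, hxk₀]
      · exact hstep' i (by omega)
    · rintro (_ | i) hi y
      · exact hg₀ y
      · exact hc.gA i (by omega) (K.mkQ y)
    · rintro (_ | i) hi y
      · rfl
      · exact hc.gB i (by omega) (K.mkQ y)
    · rintro (_ | i) hi (_ | j) hj
      · simpa using hgk
      · change g₀ (B (x j + d j)) = _
        rw [if_neg (by omega)]
        by_cases hjm : j < m
        · rw [← hstep' j hjm, hg₀, LinearMap.comp_apply, hfd 0 (by omega) (j + 1) (by omega)]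
          simp
        · obtain rfl : j = m := by omega
          rw [hdm, hcB]
      · change f' i (K.mkQ k₀) = _
        rw [hfK i _ hk₀, if_neg (by omega)]
      · change f' i (K.mkQ (x j + d j)) = _
        rw [hfd i (by omega) j (by omega)]
        simp
    · rcases hclast with h | ⟨h1, h2⟩
      · left
        change B (x m + d m) = 0
        rw [hdm, h]
      · right
        exact ⟨h1, h2⟩

namespace MatrixPair

/-- The second pair is a retract (direct summand) of the first one. -/
def Ret {p q p' q' : ℕ} (A B : Matrix (Fin p) (Fin q) ℂ) (A' B' : Matrix (Fin p') (Fin q') ℂ) :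
    Prop :=
  ∃ (i : Matrix (Fin q) (Fin q') ℂ) (s : Matrix (Fin q') (Fin q) ℂ)
    (j : Matrix (Fin p) (Fin p') ℂ) (t : Matrix (Fin p') (Fin p) ℂ),
    s * i = 1 ∧ t * j = 1 ∧ A * i = j * A' ∧ B * i = j * B' ∧
      t * A = A' * s ∧ t * B = B' * s

theorem Ret.swap {p q p' q' : ℕ} {A B : Matrix (Fin p) (Fin q) ℂ}
    {A' B' : Matrix (Fin p') (Fin q') ℂ} (h : Ret A B A' B') : Ret B A B' A' := by
  obtain ⟨i, s, j, t, h1, h2, h3, h4, h5, h6⟩ := h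
  exact ⟨i, s, j, t, h1, h2, h4, h3, h6, h5⟩

theorem Ret.transp {p q p' q' : ℕ} {A B : Matrix (Fin p) (Fin q) ℂ}
    {A' B' : Matrix (Fin p') (Fin q') ℂ} (h : Ret Aᵀ Bᵀ A' B') : Ret A B A'ᵀ B'ᵀ := by
  obtain ⟨i, s, j, t, h1, h2, h3, h4, h5, h6⟩ := h
  have e3 := congrArg Matrix.transpose h3
  have e4 := congrArg Matrix.transpose h4
  have e5 := congrArg Matrix.transpose h5
  have e6 := congrArg Matrix.transpose h6
  simp only [Matrix.transpose_mul, Matrix.transpose_transpose] at e3 e4 e5 e6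
  refine ⟨tᵀ, jᵀ, sᵀ, iᵀ, ?_, ?_, e5, e6, e3, e4⟩
  · rw [← Matrix.transpose_mul, h2, Matrix.transpose_one]
  · rw [← Matrix.transpose_mul, h1, Matrix.transpose_one]

theorem Ret.reind {p q p' q' : ℕ} {A B : Matrix (Fin p) (Fin q) ℂ}
    {A' B' : Matrix (Fin p') (Fin q') ℂ} (h : Ret A B A' B')
    (e : Fin p' ≃ Fin p') (f : Fin q' ≃ Fin q') :
    Ret A B (A'.submatrix e f) (B'.submatrix e f) := by
  obtain ⟨i, s, j, t, h1, h2, h3, h4, h5, h6⟩ := h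
  refine ⟨i.submatrix id f, s.submatrix f id, j.submatrix id e, t.submatrix e id, ?_, ?_, ?_, ?_,
    ?_, ?_⟩
  · rw [← Matrix.submatrix_mul _ _ _ _ _ Function.bijective_id, h1]; simp
  · rw [← Matrix.submatrix_mul _ _ _ _ _ Function.bijective_id, h2]; simp
  · rw [← Matrix.submatrix_mul _ _ _ _ _ e.bijective, ← h3,
      Matrix.submatrix_mul _ _ _ _ _ Function.bijective_id]; simp
  · rw [← Matrix.submatrix_mul _ _ _ _ _ e.bijective, ← h4,
      Matrix.submatrix_mul _ _ _ _ _ Function.bijective_id]; simp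
  · rw [← Matrix.submatrix_mul _ _ _ _ _ f.bijective, ← h5,
      Matrix.submatrix_mul _ _ _ _ _ Function.bijective_id]; simp
  · rw [← Matrix.submatrix_mul _ _ _ _ _ f.bijective, ← h6,
      Matrix.submatrix_mul _ _ _ _ _ Function.bijective_id]; simp

theorem Jmat_rev (n : ℕ) : (Jmat n 0)ᵀ.submatrix Fin.revPerm Fin.revPerm = Jmat n 0 := by
  ext i j
  simp only [Jmat, Matrix.submatrix_apply, Matrix.transpose_apply, Matrix.of_apply,
    Fin.revPerm_apply, Fin.val_rev]
  split_ifs <;> first | rfl | omega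

theorem Fmat_rev (n : ℕ) : (Fmat n).submatrix Fin.revPerm Fin.revPerm = Gmat n := by
  ext i j
  simp only [Fmat, Gmat, Matrix.submatrix_apply, Matrix.of_apply,
    Fin.revPerm_apply, Fin.val_rev]
  split_ifs <;> first | rfl | omega

theorem Gmat_rev (n : ℕ) : (Gmat n).submatrix Fin.revPerm Fin.revPerm = Fmat n := by
  ext i j
  simp only [Fmat, Gmat, Matrix.submatrix_apply, Matrix.of_apply,
    Fin.revPerm_apply, Fin.val_rev]
  split_ifs <;> first | rfl | omega

/-- A noninjective first matrix gives a singular summand. -/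
theorem exists_ret_core {p q : ℕ} (A B : Matrix (Fin p) (Fin q) ℂ)
    (h : LinearMap.ker A.mulVecLin ≠ ⊥) :
    ∃ n, 1 ≤ n ∧ (Ret A B (Jmat n 0) 1 ∨ Ret A B (Gmat n) (Fmat n)) := by
  obtain ⟨m, u, f, g, hc⟩ := exists_chain _ _ _ A.mulVecLin B.mulVecLin rfl h
  have hf : ∀ (F : (Fin q → ℂ) →ₗ[ℂ] ℂ) v, ∑ x, F (Pi.single x 1) * v x = F v := by
    intro F v
    conv_rhs => rw [← Finset.univ_sum_single v, map_sum]
    refine Finset.sum_congr rfl fun x _ => ?_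
    rw [mul_comm, ← smul_eq_mul, ← map_smul, ← Pi.single_smul, smul_eq_mul, mul_one]
  have hg : ∀ (F : (Fin p → ℂ) →ₗ[ℂ] ℂ) v, ∑ x, F (Pi.single x 1) * v x = F v := by
    intro F v
    conv_rhs => rw [← Finset.univ_sum_single v, map_sum]
    refine Finset.sum_congr rfl fun x _ => ?_
    rw [mul_comm, ← smul_eq_mul, ← map_smul, ← Pi.single_smul, smul_eq_mul, mul_one]
  have hAs : ∀ c, (fun x => A x c) = A.mulVecLin (Pi.single c 1) := by
    intro c; ext x; simp
  have hBs : ∀ c, (fun x => B x c) = B.mulVecLin (Pi.single c 1) := by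
    intro c; ext x; simp
  have hAu : ∀ v x, ∑ y, A x y * v y = A.mulVecLin v x := fun v x => rfl
  have hBu : ∀ v x, ∑ y, B x y * v y = B.mulVecLin v x := fun v x => rfl
  have hgA : ∀ (F : (Fin p → ℂ) →ₗ[ℂ] ℂ) c, ∑ x, F (Pi.single x 1) * A x c =
      F (A.mulVecLin (Pi.single c 1)) := by
    intro F c; rw [← hAs, ← hg]
  have hgB : ∀ (F : (Fin p → ℂ) →ₗ[ℂ] ℂ) c, ∑ x, F (Pi.single x 1) * B x c =
      F (B.mulVecLin (Pi.single c 1)) := by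
    intro F c; rw [← hBs, ← hg]
  have hgw : ∀ i < m, ∀ j ≤ m, g i (B.mulVecLin (u j)) = if i = j then 1 else 0 := by
    intro i hi j hj
    rw [hc.gB i hi, hc.dual i hi.le j hj]
  refine ⟨m + 1, by omega, ?_⟩
  rcases hc.last with hl | ⟨hl1, hl2⟩
  · right
    refine ⟨Matrix.of fun x c => u c x, Matrix.of fun r x => f r (Pi.single x 1),
      Matrix.of fun x c => B.mulVecLin (u c) x, Matrix.of fun r x => g r (Pi.single x 1),
      ?_, ?_, ?_, ?_, ?_, ?_⟩
    · ext a b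
      simp only [Matrix.mul_apply, Matrix.of_apply, hf, Matrix.one_apply, Fin.ext_iff]
      exact hc.dual _ (by omega) _ (by omega)
    · ext a b
      have := a.2
      have := b.2
      simp only [Matrix.mul_apply, Matrix.of_apply, hg, Matrix.one_apply, Fin.ext_iff]
      exact hgw _ (by omega) _ (by omega)
    · ext x b
      simp only [Matrix.mul_apply, Matrix.of_apply, hAu, Gmat]
      obtain ⟨_ | b, hb⟩ := b
      · simpa using congrFun hc.a0 x
      · rw [Finset.sum_eq_single (⟨b, by omega⟩ : Fin (m + 1 - 1))]
        · simpa using congrFun (hc.step b (by omega)) x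
        · intro c _ hne
          rw [if_neg, mul_zero]
          intro h; apply hne; ext; simp at h ⊢; omega
        · simp
    · ext x b
      simp only [Matrix.mul_apply, Matrix.of_apply, hBu, Fmat]
      by_cases hb : (b : ℕ) < m
      · rw [Finset.sum_eq_single (⟨b, by omega⟩ : Fin (m + 1 - 1))]
        · simp
        · intro c _ hne
          rw [if_neg, mul_zero]
          intro h; apply hne; ext; simp at h ⊢; omega
        · simp
      · have hbm : (b : ℕ) = m := by omega
        rw [hbm, hl, Finset.sum_eq_zero]
        · rfl
        · intro c _
          have := c.2
          rw [if_neg (by omega), mul_zero]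
    · ext a x
      have ha : (a : ℕ) < m := by have := a.2; omega
      simp only [Matrix.mul_apply, Matrix.of_apply, hgA, Gmat]
      rw [hc.gA _ ha, Finset.sum_eq_single (⟨a + 1, by omega⟩ : Fin (m + 1))]
      · simp
      · intro c _ hne
        rw [if_neg, zero_mul]
        intro h; apply hne; ext; simp at h ⊢; omega
      · simp
    · ext a x
      have ha : (a : ℕ) < m := by have := a.2; omega
      simp only [Matrix.mul_apply, Matrix.of_apply, hgB, Fmat]
      rw [hc.gB _ ha, Finset.sum_eq_single (⟨a, by omega⟩ : Fin (m + 1))]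
      · simp
      · intro c _ hne
        rw [if_neg, zero_mul]
        intro h; apply hne; ext; simp at h ⊢; omega
      · simp
  · left
    have hgB' : ∀ i ≤ m, ∀ x, g i (B.mulVecLin x) = f i x := by
      intro i hi x
      rcases hi.lt_or_eq with h | rfl
      · exact hc.gB i h x
      · exact hl1 x
    refine ⟨Matrix.of fun x c => u c x, Matrix.of fun r x => f r (Pi.single x 1),
      Matrix.of fun x c => B.mulVecLin (u c) x, Matrix.of fun r x => g r (Pi.single x 1),
      ?_, ?_, ?_, ?_, ?_, ?_⟩
    · ext a b
      simp only [Matrix.mul_apply, Matrix.of_apply, hf, Matrix.one_apply, Fin.ext_iff]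
      exact hc.dual _ (by omega) _ (by omega)
    · ext a b
      simp only [Matrix.mul_apply, Matrix.of_apply, hg, Matrix.one_apply, Fin.ext_iff]
      rw [hgB' _ (by omega)]
      exact hc.dual _ (by omega) _ (by omega)
    · ext x b
      simp only [Matrix.mul_apply, Matrix.of_apply, hAu, Jmat]
      obtain ⟨_ | b, hb⟩ := b
      · simpa using congrFun hc.a0 x
      · rw [Finset.sum_eq_single (⟨b, by omega⟩ : Fin (m + 1))]
        · simpa using congrFun (hc.step b (by omega)) x
        · intro c _ hne
          rw [if_neg (c := _ = (c : ℕ) + 1), ite_self, mul_zero]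
          intro h; apply hne; ext; simp at h ⊢; omega
        · simp
    · ext x b
      simp only [Matrix.mul_one]
      simp only [Matrix.mul_apply, Matrix.of_apply, hBu]
    · ext a x
      simp only [Matrix.mul_apply, Matrix.of_apply, hgA, Jmat]
      by_cases ha : (a : ℕ) < m
      · rw [hc.gA _ ha, Finset.sum_eq_single (⟨a + 1, by omega⟩ : Fin (m + 1))]
        · simp
        · intro c _ hne
          rw [if_neg (c := _ = (a : ℕ) + 1), ite_self, zero_mul]
          intro h; apply hne; ext; simp at h ⊢; omega
        · simp
      · have ham : (a : ℕ) = m := by omega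
        rw [ham, hl2, Finset.sum_eq_zero]
        intro c _
        rw [if_neg (c := _ = m + 1) (by omega), ite_self, zero_mul]
    · ext a x
      simp only [Matrix.one_mul]
      simp only [Matrix.mul_apply, Matrix.of_apply, hgB]
      exact hgB' _ (by omega) _

theorem exists_ret (M : MatrixPair)
    (h : ¬ (LinearMap.ker M.A.mulVecLin = ⊥ ∧ LinearMap.ker M.B.mulVecLin = ⊥ ∧
      LinearMap.ker M.Aᵀ.mulVecLin = ⊥ ∧ LinearMap.ker M.Bᵀ.mulVecLin = ⊥)) :
    ∃ P, SingularKroneckerCanonical P ∧ Ret M.A M.B P.A P.B := by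
  by_cases h1 : LinearMap.ker M.A.mulVecLin = ⊥
  · by_cases h2 : LinearMap.ker M.B.mulVecLin = ⊥
    · by_cases h3 : LinearMap.ker M.Aᵀ.mulVecLin = ⊥
      · by_cases h4 : LinearMap.ker M.Bᵀ.mulVecLin = ⊥
        · exact absurd ⟨h1, h2, h3, h4⟩ h
        · obtain ⟨n, hn, h | h⟩ := exists_ret_core M.Bᵀ M.Aᵀ h4
          · refine ⟨_, ⟨n, hn, Or.inl rfl⟩, ?_⟩
            have := (Ret.transp (Ret.swap h)).reind Fin.revPerm Fin.revPerm
            rw [Jmat_rev, Matrix.transpose_one, Matrix.submatrix_one_equiv] at this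
            exact this
          · exact ⟨_, ⟨n, hn, Or.inr (Or.inr (Or.inr rfl))⟩, Ret.transp (Ret.swap h)⟩
      · obtain ⟨n, hn, h | h⟩ := exists_ret_core M.Aᵀ M.Bᵀ h3
        · refine ⟨_, ⟨n, hn, Or.inr (Or.inl rfl)⟩, ?_⟩
          have := (Ret.transp h).reind Fin.revPerm Fin.revPerm
          rw [Jmat_rev, Matrix.transpose_one, Matrix.submatrix_one_equiv] at this
          exact this
        · refine ⟨_, ⟨n, hn, Or.inr (Or.inr (Or.inr rfl))⟩, ?_⟩
          have := (h.reind Fin.revPerm Fin.revPerm)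
          rw [Gmat_rev, Fmat_rev] at this
          exact Ret.transp this
    · obtain ⟨n, hn, h | h⟩ := exists_ret_core M.B M.A h2
      · exact ⟨_, ⟨n, hn, Or.inl rfl⟩, Ret.swap h⟩
      · exact ⟨_, ⟨n, hn, Or.inr (Or.inr (Or.inl rfl))⟩, Ret.swap h⟩
  · obtain ⟨n, hn, h | h⟩ := exists_ret_core M.A M.B h1
    · exact ⟨_, ⟨n, hn, Or.inr (Or.inl rfl)⟩, h⟩
    · refine ⟨_, ⟨n, hn, Or.inr (Or.inr (Or.inl rfl))⟩, ?_⟩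
      have := (h.reind Fin.revPerm Fin.revPerm)
      rw [Gmat_rev, Fmat_rev] at this
      exact this

theorem exists_compl {a b : ℕ} (i : Matrix (Fin b) (Fin a) ℂ) (s : Matrix (Fin a) (Fin b) ℂ)
    (h : s * i = 1) :
    ∃ (k : ℕ) (i2 : Matrix (Fin b) (Fin k) ℂ) (s2 : Matrix (Fin k) (Fin b) ℂ),
      b = a + k ∧ s2 * i2 = 1 ∧ s * i2 = 0 ∧ s2 * i = 0 ∧ i * s + i2 * s2 = 1 := by
  set e : (Fin b → ℂ) →ₗ[ℂ] (Fin b → ℂ) := Matrix.toLin' (1 - i * s) with he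
  have hidem : (1 - i * s) * (1 - i * s) = 1 - i * s := by
    have : i * s * (i * s) = i * s := by
      rw [Matrix.mul_assoc, ← Matrix.mul_assoc s, h, Matrix.one_mul]
    rw [mul_sub, sub_mul, sub_mul, this]; simp
  have hee : ∀ x, e (e x) = e x := by
    intro x
    rw [← LinearMap.comp_apply, he, ← Matrix.toLin'_mul, hidem]
  let φ := (Module.finBasis ℂ (LinearMap.range e)).equivFun
  let I := (LinearMap.range e).subtype ∘ₗ φ.symm.toLinearMap
  let S := φ.toLinearMap ∘ₗ e.rangeRestrict
  have hSI : S ∘ₗ I = LinearMap.id := by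
    apply LinearMap.ext
    intro x
    have : e.rangeRestrict (φ.symm x : Fin b → ℂ) = φ.symm x := by
      obtain ⟨y, hy⟩ := (φ.symm x).2
      ext1
      change e (φ.symm x : Fin b → ℂ) = _
      rw [← hy, hee]
    simp [S, I, this]
  have hIS : I ∘ₗ S = e := by
    apply LinearMap.ext
    intro x
    simp [S, I]
  have h1 : LinearMap.toMatrix' S * LinearMap.toMatrix' I = 1 := by
    rw [← LinearMap.toMatrix'_comp, hSI, LinearMap.toMatrix'_id]
  have h2 : LinearMap.toMatrix' I * LinearMap.toMatrix' S = 1 - i * s := by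
    rw [← LinearMap.toMatrix'_comp, hIS, he, LinearMap.toMatrix'_toLin']
  have h3 : i * s + LinearMap.toMatrix' I * LinearMap.toMatrix' S = 1 := by
    rw [h2]; abel
  refine ⟨_, LinearMap.toMatrix' I, LinearMap.toMatrix' S, ?_, h1, ?_, ?_, h3⟩
  · have := congrArg Matrix.trace h3
    rw [Matrix.trace_add, Matrix.trace_mul_comm, h, Matrix.trace_mul_comm, h1] at this
    simp only [Matrix.trace_one, Fintype.card_fin] at this
    exact_mod_cast this.symm
  · have : s * (LinearMap.toMatrix' I * LinearMap.toMatrix' S) * LinearMap.toMatrix' I = 0 := by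
      rw [h2, Matrix.mul_sub, ← Matrix.mul_assoc, h]; simp
    rwa [Matrix.mul_assoc, Matrix.mul_assoc, h1, Matrix.mul_one] at this
  · have : LinearMap.toMatrix' S * ((LinearMap.toMatrix' I * LinearMap.toMatrix' S) * i) = 0 := by
      rw [h2, Matrix.sub_mul, Matrix.mul_assoc, h]; simp
    rwa [Matrix.mul_assoc, ← Matrix.mul_assoc, h1, Matrix.one_mul] at this

/-- Simultaneous equivalence for matrices over arbitrary finite index types. -/
def GEq {α β α' β' : Type} [Fintype α] [Fintype β] [Fintype α'] [Fintype β']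
    [DecidableEq α] [DecidableEq β] [DecidableEq α'] [DecidableEq β']
    (A B : Matrix α β ℂ) (A' B' : Matrix α' β' ℂ) : Prop :=
  ∃ (R : Matrix α' α ℂ) (R' : Matrix α α' ℂ) (S : Matrix β β' ℂ) (S' : Matrix β' β ℂ),
    R * R' = 1 ∧ R' * R = 1 ∧ S * S' = 1 ∧ S' * S = 1 ∧ A' = R * A * S ∧ B' = R * B * S

section
variable {α β α' β' α'' β'' : Type} [Fintype α] [Fintype β] [Fintype α'] [Fintype β']
    [DecidableEq α] [DecidableEq β] [DecidableEq α'] [DecidableEq β']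
    [Fintype α''] [Fintype β''] [DecidableEq α''] [DecidableEq β'']

theorem GEq.trans {A B : Matrix α β ℂ} {A' B' : Matrix α' β' ℂ} {A'' B'' : Matrix α'' β'' ℂ}
    (h : GEq A B A' B') (k : GEq A' B' A'' B'') : GEq A B A'' B'' := by
  obtain ⟨R, R', S, S', h1, h2, h3, h4, h5, h6⟩ := h
  obtain ⟨T, T', U, U', k1, k2, k3, k4, k5, k6⟩ := k
  refine ⟨T * R, R' * T', S * U, U' * S', ?_, ?_, ?_, ?_, ?_, ?_⟩
  · rw [Matrix.mul_assoc, ← Matrix.mul_assoc R, h1, Matrix.one_mul, k1]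
  · rw [Matrix.mul_assoc, ← Matrix.mul_assoc T', k2, Matrix.one_mul, h2]
  · rw [Matrix.mul_assoc, ← Matrix.mul_assoc U, k3, Matrix.one_mul, h3]
  · rw [Matrix.mul_assoc, ← Matrix.mul_assoc S', h4, Matrix.one_mul, k4]
  · rw [k5, h5]; simp only [Matrix.mul_assoc]
  · rw [k6, h6]; simp only [Matrix.mul_assoc]

theorem GEq.symm {A B : Matrix α β ℂ} {A' B' : Matrix α' β' ℂ}
    (h : GEq A B A' B') : GEq A' B' A B := by
  obtain ⟨R, R', S, S', h1, h2, h3, h4, h5, h6⟩ := h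
  have key : ∀ X : Matrix α β ℂ, X = R' * (R * X * S) * S' := by
    intro X
    rw [Matrix.mul_assoc R, ← Matrix.mul_assoc R', h2, Matrix.one_mul, Matrix.mul_assoc, h3,
      Matrix.mul_one]
  exact ⟨R', R, S', S, h2, h1, h4, h3, by rw [h5]; exact key A, by rw [h6]; exact key B⟩

theorem GEq.sub (A B : Matrix α β ℂ) (e : α' ≃ α) (f : β' ≃ β) :
    GEq A B (A.submatrix e f) (B.submatrix e f) := by
  refine ⟨(1 : Matrix α α ℂ).submatrix e id, (1 : Matrix α α ℂ).submatrix id e,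
    (1 : Matrix β β ℂ).submatrix id f, (1 : Matrix β β ℂ).submatrix f id, ?_, ?_, ?_, ?_, ?_, ?_⟩
  · rw [← Matrix.submatrix_mul _ _ _ _ _ Function.bijective_id]; simp
  · rw [← Matrix.submatrix_mul _ _ _ _ _ e.bijective]; simp
  · rw [← Matrix.submatrix_mul _ _ _ _ _ f.bijective]; simp
  · rw [← Matrix.submatrix_mul _ _ _ _ _ Function.bijective_id]; simp
  · have : A.submatrix e f = ((1 : Matrix α α ℂ) * A * (1 : Matrix β β ℂ)).submatrix e f := by simp
    rw [this, Matrix.submatrix_mul _ _ _ id _ Function.bijective_id,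
      Matrix.submatrix_mul _ _ _ id _ Function.bijective_id]; simp
  · have : B.submatrix e f = ((1 : Matrix α α ℂ) * B * (1 : Matrix β β ℂ)).submatrix e f := by simp
    rw [this, Matrix.submatrix_mul _ _ _ id _ Function.bijective_id,
      Matrix.submatrix_mul _ _ _ id _ Function.bijective_id]; simp

theorem GEq.blocks {γ δ : Type} [Fintype γ] [Fintype δ] [DecidableEq γ] [DecidableEq δ]
    (X Y : Matrix γ δ ℂ) {A B : Matrix α β ℂ} {A' B' : Matrix α' β' ℂ} (h : GEq A B A' B') :
    GEq (Matrix.fromBlocks X 0 0 A) (Matrix.fromBlocks Y 0 0 B)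
      (Matrix.fromBlocks X 0 0 A') (Matrix.fromBlocks Y 0 0 B') := by
  obtain ⟨R, R', S, S', h1, h2, h3, h4, h5, h6⟩ := h
  refine ⟨Matrix.fromBlocks 1 0 0 R, Matrix.fromBlocks 1 0 0 R', Matrix.fromBlocks 1 0 0 S,
    Matrix.fromBlocks 1 0 0 S', ?_, ?_, ?_, ?_, ?_, ?_⟩ <;>
    simp [Matrix.fromBlocks_multiply, *]

end

theorem simEquiv_iff (P Q : MatrixPair) : SimEquiv P Q ↔ GEq P.A P.B Q.A Q.B := Iff.rfl

theorem geq_dsum (P Q : MatrixPair) : GEq (Matrix.fromBlocks P.A 0 0 Q.A)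
    (Matrix.fromBlocks P.B 0 0 Q.B) (P.dsum Q).A (P.dsum Q).B :=
  GEq.sub _ _ finSumFinEquiv.symm finSumFinEquiv.symm

theorem dsum_geq (P Q : MatrixPair) : GEq (P.dsum Q).A (P.dsum Q).B
    (Matrix.fromBlocks P.A 0 0 Q.A) (Matrix.fromBlocks P.B 0 0 Q.B) := (geq_dsum P Q).symm

theorem dsum_congr (P : MatrixPair) {Q Q' : MatrixPair} (h : SimEquiv Q Q') :
    SimEquiv (P.dsum Q) (P.dsum Q') :=
  ((dsum_geq P Q).trans (GEq.blocks P.A P.B h)).trans (geq_dsum P Q')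

theorem dsum_assoc (P Q N : MatrixPair) :
    SimEquiv (P.dsum (Q.dsum N)) ((P.dsum Q).dsum N) := by
  refine ((dsum_geq P _).trans (GEq.blocks P.A P.B (dsum_geq Q N))).trans
    (GEq.trans ?_ (geq_dsum _ N))
  have := GEq.sub (Matrix.fromBlocks P.A 0 0 (Matrix.fromBlocks Q.A 0 0 N.A))
    (Matrix.fromBlocks P.B 0 0 (Matrix.fromBlocks Q.B 0 0 N.B))
    (((Equiv.sumCongr finSumFinEquiv.symm (Equiv.refl (Fin N.p))).trans
      (Equiv.sumAssoc (Fin P.p) (Fin Q.p) (Fin N.p))))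
    (((Equiv.sumCongr finSumFinEquiv.symm (Equiv.refl (Fin N.q))).trans
      (Equiv.sumAssoc (Fin P.q) (Fin Q.q) (Fin N.q))))
  have key : ∀ (a : Matrix (Fin P.p) (Fin P.q) ℂ) (b : Matrix (Fin Q.p) (Fin Q.q) ℂ)
      (c : Matrix (Fin N.p) (Fin N.q) ℂ),
      (Matrix.fromBlocks a 0 0 (Matrix.fromBlocks b 0 0 c)).submatrix
      (((Equiv.sumCongr finSumFinEquiv.symm (Equiv.refl (Fin N.p))).trans
      (Equiv.sumAssoc (Fin P.p) (Fin Q.p) (Fin N.p))))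
      (((Equiv.sumCongr finSumFinEquiv.symm (Equiv.refl (Fin N.q))).trans
      (Equiv.sumAssoc (Fin P.q) (Fin Q.q) (Fin N.q)))) =
      Matrix.fromBlocks (Matrix.reindex finSumFinEquiv finSumFinEquiv (Matrix.fromBlocks a 0 0 b))
        0 0 c := by
    intro a b c
    ext x y
    rcases x with x | x <;> rcases y with y | y
    · obtain ⟨x, rfl⟩ := finSumFinEquiv.surjective x
      obtain ⟨y, rfl⟩ := finSumFinEquiv.surjective y
      rcases x with x | x <;> rcases y with y | y <;> simp
    · obtain ⟨x, rfl⟩ := finSumFinEquiv.surjective x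
      rcases x with x | x <;> simp
    · obtain ⟨y, rfl⟩ := finSumFinEquiv.surjective y
      rcases y with y | y <;> simp
    · simp
  rw [key, key] at this
  exact this

theorem Ret.split {M P : MatrixPair} (h : Ret M.A M.B P.A P.B) :
    ∃ N : MatrixPair, M.p = P.p + N.p ∧ M.q = P.q + N.q ∧ SimEquiv M (P.dsum N) := by
  obtain ⟨i, s, j, t, h1, h2, h3, h4, h5, h6⟩ := h
  obtain ⟨k, i2, s2, hk, a1, a2, a3, a4⟩ := exists_compl i s h1
  obtain ⟨l, j2, t2, hl, b1, b2, b3, b4⟩ := exists_compl j t h2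
  refine ⟨⟨l, k, t2 * M.A * i2, t2 * M.B * i2⟩, hl, hk, ?_⟩
  refine GEq.trans ?_ (geq_dsum _ _)
  refine ⟨Matrix.fromRows t t2, Matrix.fromCols j j2, Matrix.fromCols i i2, Matrix.fromRows s s2,
    ?_, ?_, ?_, ?_, ?_, ?_⟩
  · rw [Matrix.fromRows_mul_fromCols, h2, b1, b2, b3, Matrix.fromBlocks_one]
  · rw [Matrix.fromCols_mul_fromRows, b4]
  · rw [Matrix.fromCols_mul_fromRows, a4]
  · rw [Matrix.fromRows_mul_fromCols, h1, a1, a2, a3, Matrix.fromBlocks_one]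
  · rw [Matrix.fromRows_mul, Matrix.fromRows_mul_fromCols, h5, Matrix.mul_assoc P.A, h1,
      Matrix.mul_assoc P.A, a2, Matrix.mul_assoc t2 M.A i, h3, ← Matrix.mul_assoc t2 j, b3]
    simp
  · rw [Matrix.fromRows_mul, Matrix.fromRows_mul_fromCols, h6, Matrix.mul_assoc P.B, h1,
      Matrix.mul_assoc P.B, a2, Matrix.mul_assoc t2 M.B i, h4, ← Matrix.mul_assoc t2 j, b3]
    simp

theorem zero_dsum (M : MatrixPair) : SimEquiv M (zero.dsum M) := by
  refine GEq.trans ?_ (geq_dsum _ _)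
  have := GEq.sub M.A M.B (Equiv.emptySum (Fin 0) (Fin M.p)) (Equiv.emptySum (Fin 0) (Fin M.q))
  have key : ∀ (a : Matrix (Fin 0) (Fin 0) ℂ) (c : Matrix (Fin M.p) (Fin M.q) ℂ),
      c.submatrix (Equiv.emptySum (Fin 0) (Fin M.p)) (Equiv.emptySum (Fin 0) (Fin M.q)) =
        Matrix.fromBlocks a 0 0 c := by
    intro a c
    ext x y
    rcases x with x | x
    · exact x.elim0
    · rcases y with y | y
      · exact y.elim0
      · simp
  rw [key zero.A, key zero.B] at this
  exact this

theorem canonical_pos {P : MatrixPair} (h : SingularKroneckerCanonical P) : 0 < P.p + P.q := by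
  obtain ⟨n, hn, rfl | rfl | rfl | rfl⟩ := h <;> dsimp only <;> omega

theorem decomp : ∀ (k : ℕ) (M : MatrixPair), M.p + M.q = k →
    ∃ (L : List MatrixPair) (m : ℕ) (C D : Matrix (Fin m) (Fin m) ℂ),
      (∀ P ∈ L, SingularKroneckerCanonical P) ∧ IsUnit C ∧ IsUnit D ∧
      SimEquiv M ((dsumList L).dsum ⟨m, m, C, D⟩) := by
  intro k
  induction k using Nat.strong_induction_on with
  | _ k ih =>
  intro M hM
  by_cases h : (LinearMap.ker M.A.mulVecLin = ⊥ ∧ LinearMap.ker M.B.mulVecLin = ⊥ ∧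
      LinearMap.ker M.Aᵀ.mulVecLin = ⊥ ∧ LinearMap.ker M.Bᵀ.mulVecLin = ⊥)
  · obtain ⟨p, q, A, B⟩ := M
    obtain ⟨h1, h2, h3, h4⟩ := h
    dsimp only at h1 h2 h3 h4
    rw [LinearMap.ker_eq_bot] at h1 h2 h3 h4
    have e1 := LinearMap.finrank_le_finrank_of_injective h1
    have e2 := LinearMap.finrank_le_finrank_of_injective h3
    simp only [Module.finrank_fin_fun] at e1 e2
    obtain rfl : p = q := by omega
    exact ⟨[], p, A, B, by simp, Matrix.mulVec_injective_iff_isUnit.1 h1,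
      Matrix.mulVec_injective_iff_isUnit.1 h2, zero_dsum _⟩
  · obtain ⟨P, hP, hret⟩ := exists_ret M h
    obtain ⟨N, hp, hq, hN⟩ := Ret.split hret
    have := canonical_pos hP
    obtain ⟨L, m, C, D, hL, hC, hD, hS⟩ := ih (N.p + N.q) (by omega) N rfl
    refine ⟨P :: L, m, C, D, ?_, hC, hD, ?_⟩
    · intro Q hQ
      rcases List.mem_cons.1 hQ with rfl | hQ
      · exact hP
      · exact hL Q hQ
    · exact (GEq.trans hN (dsum_congr P hS)).trans (dsum_assoc P _ _)

end MatrixPair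

/-- Van Dooren's regularizing decomposition: every pair of `p × q` complex matrices is
simultaneously equivalent to a direct sum of singular canonical pairs together with a
regular part `(C, D)` consisting of two invertible square matrices of equal size. -/
theorem regularizing_decomposition_pencil (p q : ℕ) (A B : Matrix (Fin p) (Fin q) ℂ) :
    ∃ (L : List MatrixPair) (m : ℕ) (C D : Matrix (Fin m) (Fin m) ℂ),
      (∀ P ∈ L, SingularKroneckerCanonical P) ∧ IsUnit C ∧ IsUnit D ∧
      MatrixPair.SimEquiv ⟨p, q, A, B⟩ ((MatrixPair.dsumList L).dsum ⟨m, m, C, D⟩) := by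
  exact MatrixPair.decomp _ ⟨p, q, A, B⟩ rfl
end

section
/- If a matrix representation (A₁,…,A_t) of the cycle quiver with vertices 1,…,t (with an arbitrary fixed orientation of the arrows) over ℂ is indecomposable, then at least t−2 of the matrices A₁,…,A_t are square and invertible (equivalently, at most 2 of them fail to be square invertible). -/
open Matrix

namespace CycleQuiver

section abstract_cycle
set_option linter.unusedSectionVars false

variable {ι : Type} [Fintype ι] [DecidableEq ι] {V : ι → Type} [∀ v, AddCommGroup (V v)]
  [∀ v, Module ℂ (V v)] [∀ v, FiniteDimensional ℂ (V v)] {σ : Equiv.Perm ι} (o : ι → Bool)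
  (f : ∀ u, V u →ₗ[ℂ] V (σ u)) (b : ∀ u, V (σ u) →ₗ[ℂ] V u)

/-- Data of a string starting at `v`, with initial vector in `K` and initial covector
vanishing on `N`. -/
def Str (v : ι) (N K : Submodule ℂ (V v)) : Prop :=
  ∃ (x : V v) (φ : V v →ₗ[ℂ] ℂ) (P R : ∀ u, V u →ₗ[ℂ] V u)
    (F : ∀ u, V u →ₗ[ℂ] V (σ u)) (H : ∀ u, V (σ u) →ₗ[ℂ] V u) (l : ι) (c : ι → ℕ),
    x ∈ K ∧ (∀ y ∈ N, φ y = 0) ∧ φ x = 1 ∧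
    (∀ u, o u = true → F u = f u) ∧ (∀ u, o u = false → H u = b u) ∧
    (∀ u, P (σ u) = F u ∘ₗ H u +
      (Pi.single v (φ.smulRight x) : ∀ u, V u →ₗ[ℂ] V u) (σ u)) ∧
    (∀ u, P u = H u ∘ₗ F u + R u) ∧
    (∀ u, o u = true → f u ∘ₗ R u = 0) ∧ (∀ u, o u = false → R u ∘ₗ b u = 0) ∧
    (∀ u, u ≠ l → R u = 0) ∧
    (∀ u, LinearMap.trace ℂ (V u) (P u) = c u) ∧ 1 ≤ c v

theorem trace_single (v : ι) (x : V v) (φ : V v →ₗ[ℂ] ℂ) (h : φ x = 1) (u : ι) :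
    LinearMap.trace ℂ (V u) ((Pi.single v (φ.smulRight x) : ∀ u, V u →ₗ[ℂ] V u) u) =
      ((if u = v then 1 else 0 : ℕ) : ℂ) := by
  by_cases huv : u = v
  · subst huv
    simp [LinearMap.trace_smulRight, h]
  · simp [huv]

theorem str_base (v : ι) (N K : Submodule ℂ (V v)) (x : V v) (φ : V v →ₗ[ℂ] ℂ)
    (hx : x ∈ K) (hφ : ∀ y ∈ N, φ y = 0) (h1 : φ x = 1)
    (ht : o v = true → f v x = 0) (hf : o v = false → ∀ y, φ (b v y) = 0) :
    Str o f b v N K := by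
  refine ⟨x, φ, Pi.single v (φ.smulRight x), Pi.single v (φ.smulRight x),
    fun u => if o u then f u else 0, fun u => if o u then 0 else b u, v,
    fun u => if u = v then 1 else 0, hx, hφ, h1, ?_, ?_, ?_, ?_, ?_, ?_, ?_, ?_, ?_⟩
  · intro u hu; simp [hu]
  · intro u hu; simp [hu]
  · intro u; cases hu : o u <;> simp [hu]
  · intro u; cases hu : o u <;> simp [hu]
  · intro u hu
    by_cases huv : u = v
    · subst huv
      ext y
      simp [ht hu]
    · simp [huv]
  · intro u hu
    by_cases huv : u = v
    · subst huv
      ext y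
      simp [hf hu]
    · simp [huv]
  · intro u hu; simp [hu]
  · intro u; exact trace_single v x φ h1 u
  · simp

/-- prolongation across an arrow `v → σ v` -/
theorem str_step_true (v : ι) (N K : Submodule ℂ (V v)) (N' K' : Submodule ℂ (V (σ v)))
    (hv : o v = true) (h : Str o f b (σ v) N' K')
    (hK : ∀ x' ∈ K', ∃ x ∈ K, f v x = x') (hN : ∀ y ∈ N, f v y ∈ N') :
    Str o f b v N K := by
  obtain ⟨x', φ', P, R, F, H, l, c, hx', hφ', h1, hF, hH, hP1, hP2, hR1, hR2, hl, hc, hc1⟩ := h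
  obtain ⟨x, hx, hfx⟩ := hK x' hx'
  have h2 : (φ' ∘ₗ f v) x = 1 := by simp [hfx, h1]
  refine ⟨x, φ' ∘ₗ f v, P + (Pi.single v ((φ' ∘ₗ f v).smulRight x)), R, F,
    H + Pi.single v (φ'.smulRight x), l, fun u => c u + if u = v then 1 else 0, hx,
    fun y hy => hφ' _ (hN y hy), h2, hF, ?_, ?_, ?_, hR1, hR2, hl, ?_, ?_⟩
  · intro u hu
    have : u ≠ v := by rintro rfl; simp [hv] at hu
    simp [this, hH u hu]
  · intro u
    rw [Pi.add_apply, hP1]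
    congr 1
    by_cases huv : u = v
    · subst huv
      ext y
      simp [hF u hv, hfx]
    · simp [huv]
  · intro u
    rw [Pi.add_apply, hP2]
    by_cases huv : u = v
    · subst huv
      ext y
      simp [hF u hv]
      abel
    · simp [huv]
  · intro u
    rw [Pi.add_apply, map_add, hc, trace_single v x _ h2]
    push_cast; rfl
  · simp

/-- prolongation across an arrow `σ v → v` -/
theorem str_step_false (v : ι) (N K : Submodule ℂ (V v)) (N' K' : Submodule ℂ (V (σ v)))
    (hv : o v = false) (h : Str o f b (σ v) N' K')
    (hK : ∀ x' ∈ K', b v x' ∈ K)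
    (hN : ∀ φ' : V (σ v) →ₗ[ℂ] ℂ, (∀ y ∈ N', φ' y = 0) →
      ∃ φ : V v →ₗ[ℂ] ℂ, (∀ y ∈ N, φ y = 0) ∧ φ ∘ₗ b v = φ') :
    Str o f b v N K := by
  obtain ⟨x', φ', P, R, F, H, l, c, hx', hφ', h1, hF, hH, hP1, hP2, hR1, hR2, hl, hc, hc1⟩ := h
  obtain ⟨φ, hφ, hfφ⟩ := hN φ' hφ'
  have h2 : φ (b v x') = 1 := by rw [← h1, ← hfφ]; rfl
  refine ⟨b v x', φ, P + (Pi.single v (φ.smulRight (b v x'))), R,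
    F + Pi.single v (φ.smulRight x'), H, l, fun u => c u + if u = v then 1 else 0, hK _ hx',
    hφ, h2, ?_, hH, ?_, ?_, hR1, hR2, hl, ?_, ?_⟩
  · intro u hu
    have : u ≠ v := by rintro rfl; simp [hv] at hu
    simp [this, hF u hu]
  · intro u
    rw [Pi.add_apply, hP1]
    congr 1
    by_cases huv : u = v
    · subst huv
      ext y
      simp [hH u hv, ← hfφ]
    · simp [huv]
  · intro u
    rw [Pi.add_apply, hP2]
    by_cases huv : u = v
    · subst huv
      ext y
      simp [hH u hv]
      abel
    · simp [huv]
  · intro u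
    rw [Pi.add_apply, map_add, hc, trace_single v _ _ h2]
    push_cast; rfl
  · simp

/-- Transport of a subspace along an arrow (as a linear relation). -/
def push (v : ι) (M : Submodule ℂ (V v)) : Submodule ℂ (V (σ v)) :=
  if o v then M.map (f v) else M.comap (b v)

theorem push_mono (v : ι) {M M' : Submodule ℂ (V v)} (h : M ≤ M') :
    push o f b v M ≤ push o f b v M' := by
  unfold push
  split
  · exact Submodule.map_mono h
  · exact Submodule.comap_mono h

theorem exists_functional {W : Type} [AddCommGroup W] [Module ℂ W] (N : Submodule ℂ W) (x : W)
    (hx : x ∉ N) : ∃ φ : W →ₗ[ℂ] ℂ, (∀ y ∈ N, φ y = 0) ∧ φ x = 1 := by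
  obtain ⟨φ, h1, h2⟩ := Submodule.exists_le_ker_of_notMem hx
  refine ⟨(φ x)⁻¹ • φ, fun y hy => ?_, ?_⟩
  · have : φ y = 0 := h2 hy
    simp [this]
  · simp [h1]

theorem str_or_step (v : ι) (N K : Submodule ℂ (V v)) (hNK : N < K) :
    Str o f b v N K ∨
      (push o f b v N < push o f b v K ∧
        (Str o f b (σ v) (push o f b v N) (push o f b v K) → Str o f b v N K)) := by
  by_cases hv : o v = true
  · by_cases hk : ∃ x ∈ K, f v x = 0 ∧ x ∉ N
    · left
      obtain ⟨x, hx, h0, hxN⟩ := hk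
      obtain ⟨φ, hφ, h1⟩ := exists_functional N x hxN
      exact str_base o f b v N K x φ hx hφ h1 (fun _ => h0) (by simp [hv])
    · right
      push Not at hk
      have e1 : push o f b v N = N.map (f v) := by simp [push, hv]
      have e2 : push o f b v K = K.map (f v) := by simp [push, hv]
      rw [e1, e2]
      refine ⟨lt_of_le_not_ge (Submodule.map_mono hNK.le) fun h => ?_, fun h => ?_⟩
      · apply hNK.not_ge
        intro x hx
        obtain ⟨n, hn, hnx⟩ := h (Submodule.mem_map_of_mem hx)
        have := hk (x - n) (K.sub_mem hx (hNK.le hn)) (by simp [hnx])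
        simpa using N.add_mem this hn
      · exact str_step_true o f b v N K _ _ hv h (fun x' hx' => hx')
          (fun y hy => Submodule.mem_map_of_mem hy)
  · have hv : o v = false := by simpa using hv
    by_cases hk : K ≤ N ⊔ LinearMap.range (b v)
    · right
      have e1 : push o f b v N = N.comap (b v) := by simp [push, hv]
      have e2 : push o f b v K = K.comap (b v) := by simp [push, hv]
      rw [e1, e2]
      refine ⟨lt_of_le_not_ge (Submodule.comap_mono hNK.le) fun h => ?_, fun h => ?_⟩
      · apply hNK.not_ge
        intro x hx
        obtain ⟨n, hn, _, ⟨u, rfl⟩, rfl⟩ := Submodule.mem_sup.1 (hk hx)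
        have : u ∈ K.comap (b v) := by
          have := K.sub_mem hx (hNK.le hn)
          simpa using this
        exact N.add_mem hn (h this)
      · refine str_step_false o f b v N K _ _ hv h (fun x' hx' => hx') fun φ' hφ' => ?_
        have hmem : φ' ∈ (LinearMap.ker (N.mkQ ∘ₗ b v)).dualAnnihilator := by
          rw [Submodule.mem_dualAnnihilator]
          intro y hy
          apply hφ'
          simpa using hy
        rw [← LinearMap.range_dualMap_eq_dualAnnihilator_ker] at hmem
        obtain ⟨ψ, hψ⟩ := hmem
        refine ⟨ψ ∘ₗ N.mkQ, fun y hy => ?_, ?_⟩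
        · have : N.mkQ y = 0 := by simpa using hy
          rw [LinearMap.comp_apply, this, map_zero]
        · rw [← hψ]; rfl
    · left
      obtain ⟨x, hx, hxN⟩ := SetLike.not_le_iff_exists.1 hk
      obtain ⟨φ, hφ, h1⟩ := exists_functional _ x hxN
      exact str_base o f b v N K x φ hx (fun y hy => hφ y (Submodule.mem_sup_left hy)) h1
        (by simp [hv]) (fun _ y => hφ _ (Submodule.mem_sup_right ⟨y, rfl⟩))


/-- walk around the cycle -/
def walk (s : ι) (p : Submodule ℂ (V s) × Submodule ℂ (V s)) :
    ℕ → Σ v, Submodule ℂ (V v) × Submodule ℂ (V v)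
  | 0 => ⟨s, p⟩
  | k + 1 => ⟨σ (walk s p k).1, push o f b _ (walk s p k).2.1, push o f b _ (walk s p k).2.2⟩

/-- Comparison of subspaces at propositionally equal vertices. -/
def SLE (a : ι) (M : Submodule ℂ (V a)) (c : ι) (M' : Submodule ℂ (V c)) : Prop :=
  ∃ h : a = c, h ▸ M ≤ M'

theorem push_sle {a c : ι} {M : Submodule ℂ (V a)} {M' : Submodule ℂ (V c)}
    (h : SLE a M c M') : SLE (σ a) (push o f b a M) (σ c) (push o f b c M') := by
  obtain ⟨rfl, h⟩ := h
  exact ⟨rfl, push_mono o f b a h⟩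

theorem walk_or (s : ι) (N K : Submodule ℂ (V s)) (hNK : N < K) (hs : ¬ Str o f b s N K) (k : ℕ) :
    (walk o f b s (N, K) k).2.1 < (walk o f b s (N, K) k).2.2 ∧
    ¬ Str o f b (walk o f b s (N, K) k).1 (walk o f b s (N, K) k).2.1
      (walk o f b s (N, K) k).2.2 := by
  induction k with
  | zero => exact ⟨hNK, hs⟩
  | succ k ih =>
    rcases str_or_step o f b _ _ _ ih.1 with h | ⟨h, h'⟩
    · exact absurd h ih.2
    · exact ⟨h, fun hh => ih.2 (h' hh)⟩

theorem exists_repeat (s : ι) (p : Submodule ℂ (V s) × Submodule ℂ (V s)) :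
    ∃ k m : ℕ, (walk o f b s p k).1 = (walk o f b s p (k + m + 1)).1 ∧
      Module.finrank ℂ (walk o f b s p k).2.2 =
        Module.finrank ℂ (walk o f b s p (k + m + 1)).2.2 := by
  let D := ∑ v, Module.finrank ℂ (V v)
  have hD : ∀ k, Module.finrank ℂ (walk o f b s p k).2.2 < D + 1 := fun k =>
    Nat.lt_succ_of_le ((Submodule.finrank_le _).trans
      (Finset.single_le_sum (f := fun v => Module.finrank ℂ (V v)) (fun _ _ => Nat.zero_le _)
        (Finset.mem_univ _)))
  obtain ⟨i, j, hij, h⟩ := Finite.exists_ne_map_eq_of_infinite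
    (fun k : ℕ => ((walk o f b s p k).1, (⟨_, hD k⟩ : Fin (D + 1))))
  simp only [Prod.mk.injEq, Fin.mk.injEq] at h
  rcases lt_or_gt_of_ne hij with h' | h'
  · obtain ⟨m, rfl⟩ := Nat.exists_eq_add_of_lt h'
    exact ⟨i, m, h⟩
  · obtain ⟨m, rfl⟩ := Nat.exists_eq_add_of_lt h'
    exact ⟨j, m, h.1.symm, h.2.symm⟩

theorem sle_of_lt {a c : ι} {M : Submodule ℂ (V a)} {N K : Submodule ℂ (V c)}
    (h : SLE a M c N) (hNK : N < K) : Module.finrank ℂ M < Module.finrank ℂ K := by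
  obtain ⟨rfl, h⟩ := h
  exact Submodule.finrank_lt_finrank_of_lt (lt_of_le_of_lt h hNK)

theorem str_coker (v : ι) (hv : o v = true) (h : LinearMap.range (f v) ≠ ⊤) :
    Str o f b (σ v) (LinearMap.range (f v)) ⊤ := by
  by_contra hs
  have hw := walk_or o f b (σ v) _ _ (lt_top_iff_ne_top.2 h) hs
  have key : ∀ k m, (walk o f b (σ v) (LinearMap.range (f v), ⊤) k).1 =
      (walk o f b (σ v) (LinearMap.range (f v), ⊤) (k + m + 1)).1 →
      SLE _ (walk o f b (σ v) (LinearMap.range (f v), ⊤) (k + m + 1)).2.2 _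
        (walk o f b (σ v) (LinearMap.range (f v), ⊤) k).2.1 := by
    intro k m
    induction k with
    | zero =>
      intro h
      have gen : ∀ (a : ι) (M : Submodule ℂ (V a)), a = v →
          SLE (σ a) (push o f b a M) (σ v) (LinearMap.range (f v)) := by
        rintro a M rfl
        refine ⟨rfl, ?_⟩
        simp only [push, hv, if_true]
        exact LinearMap.map_le_range
      rw [Nat.zero_add] at *
      exact gen _ _ (σ.injective h.symm)
    | succ k ih =>
      intro h
      rw [show k + 1 + m + 1 = (k + m + 1) + 1 by omega] at *
      exact push_sle o f b (ih (σ.injective h))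
  obtain ⟨k, m, h1, h2⟩ := exists_repeat o f b (σ v) (LinearMap.range (f v), ⊤)
  exact absurd (sle_of_lt (key k m h1) (hw k).1) (by rw [h2]; exact lt_irrefl _)

theorem str_ker (v : ι) (hv : o v = false) (h : LinearMap.ker (b v) ≠ ⊥) :
    Str o f b (σ v) ⊥ (LinearMap.ker (b v)) := by
  by_contra hs
  have hw := walk_or o f b (σ v) _ _ (bot_lt_iff_ne_bot.2 h) hs
  have key : ∀ k m, (walk o f b (σ v) (⊥, LinearMap.ker (b v)) k).1 =
      (walk o f b (σ v) (⊥, LinearMap.ker (b v)) (k + m + 1)).1 →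
      SLE _ (walk o f b (σ v) (⊥, LinearMap.ker (b v)) k).2.2 _
        (walk o f b (σ v) (⊥, LinearMap.ker (b v)) (k + m + 1)).2.1 := by
    intro k m
    induction k with
    | zero =>
      intro h
      have gen : ∀ (a : ι) (M : Submodule ℂ (V a)), a = v →
          SLE (σ v) (LinearMap.ker (b v)) (σ a) (push o f b a M) := by
        rintro a M rfl
        refine ⟨rfl, ?_⟩
        simp only [push, hv]
        exact LinearMap.ker_le_comap _
      rw [Nat.zero_add] at *
      exact gen _ _ (σ.injective h.symm)
    | succ k ih =>
      intro h
      rw [show k + 1 + m + 1 = (k + m + 1) + 1 by omega] at *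
      exact push_sle o f b (ih (σ.injective h))
  obtain ⟨k, m, h1, h2⟩ := exists_repeat o f b (σ v) (⊥, LinearMap.ker (b v))
  exact absurd (sle_of_lt (key k m h1) (hw (k + m + 1)).1) (by rw [h2]; exact lt_irrefl _)

/-- From a string to the conclusion. -/
theorem finish (v : ι) (N K : Submodule ℂ (V (σ v))) (h : Str o f b (σ v) N K)
    (hN : o v = true → LinearMap.range (f v) ≤ N) (hK : o v = false → K ≤ LinearMap.ker (b v))
    (hind : ∀ P : ∀ u, V u →ₗ[ℂ] V u, (∀ u, o u = true → P (σ u) ∘ₗ f u = f u ∘ₗ P u) →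
      (∀ u, o u = false → P u ∘ₗ b u = b u ∘ₗ P (σ u)) →
      (∃ u, LinearMap.trace ℂ (V u) (P u) ≠ 0) → ∀ u, Function.Bijective (P u)) :
    ∃ l, ∀ u, u ≠ v → u ≠ l → (o u = true → Function.Bijective (f u)) ∧
      (o u = false → Function.Bijective (b u)) := by
  obtain ⟨x, φ, P, R, F, H, l, c, hx, hφ, h1, hF, hH, hP1, hP2, hR1, hR2, hl, hc, hc1⟩ := h
  have hb : ∀ u, Function.Bijective (P u) := by
    apply hind P
    · intro u hu
      rw [hP1, hP2, ← hF u hu, LinearMap.add_comp, LinearMap.comp_add, LinearMap.comp_assoc,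
        hF u hu, hR1 u hu, add_zero, add_eq_left]
      by_cases huv : u = v
      · subst huv
        ext y
        have : φ (f u y) = 0 := hφ _ (hN hu ⟨y, rfl⟩)
        simp [this]
      · simp [huv]
    · intro u hu
      rw [hP1, hP2, ← hH u hu, LinearMap.add_comp, LinearMap.comp_add, LinearMap.comp_assoc,
        hH u hu, hR2 u hu, add_zero, left_eq_add]
      by_cases huv : u = v
      · subst huv
        ext y
        have : b u x = 0 := hK hu hx
        simp [this]
      · simp [huv]
    · refine ⟨σ v, ?_⟩
      rw [hc]
      exact_mod_cast (by omega : c (σ v) ≠ 0)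
  refine ⟨l, fun u huv hul => ?_⟩
  have e1 : P (σ u) = F u ∘ₗ H u := by rw [hP1]; simp [huv]
  have e2 : P u = H u ∘ₗ F u := by rw [hP2, hl u hul, add_zero]
  have b1 := hb (σ u)
  have b2 := hb u
  rw [e1, LinearMap.coe_comp] at b1
  rw [e2, LinearMap.coe_comp] at b2
  refine ⟨fun hu => ?_, fun hu => ?_⟩
  · rw [← hF u hu]; exact ⟨b2.1.of_comp, b1.2.of_comp⟩
  · rw [← hH u hu]; exact ⟨b1.1.of_comp, b2.2.of_comp⟩

theorem dims (h1 : ∀ u, o u = true → Function.Surjective (f u))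
    (h2 : ∀ u, o u = false → Function.Injective (b u)) (u : ι) :
    (o u = true → Function.Bijective (f u)) ∧ (o u = false → Function.Bijective (b u)) := by
  have hle : ∀ u, Module.finrank ℂ (V (σ u)) ≤ Module.finrank ℂ (V u) := by
    intro u
    cases hu : o u
    · exact LinearMap.finrank_le_finrank_of_injective (h2 u hu)
    · exact LinearMap.finrank_le_finrank_of_surjective (h1 u hu)
  have heq := (Finset.sum_eq_sum_iff_of_le (fun u _ => hle u)).1
    (Equiv.sum_comp σ (fun v => Module.finrank ℂ (V v))) u (Finset.mem_univ _)
  refine ⟨fun hu => ⟨?_, h1 u hu⟩, fun hu => ⟨h2 u hu, ?_⟩⟩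
  · exact (LinearMap.injective_iff_surjective_of_finrank_eq_finrank heq.symm).2 (h1 u hu)
  · exact (LinearMap.injective_iff_surjective_of_finrank_eq_finrank heq).1 (h2 u hu)

theorem abstract_main 
    (hind : ∀ P : ∀ u, V u →ₗ[ℂ] V u, (∀ u, o u = true → P (σ u) ∘ₗ f u = f u ∘ₗ P u) →
      (∀ u, o u = false → P u ∘ₗ b u = b u ∘ₗ P (σ u)) →
      (∃ u, LinearMap.trace ℂ (V u) (P u) ≠ 0) → ∀ u, Function.Bijective (P u)) :
    Set.ncard {u | ¬ ((o u = true → Function.Bijective (f u)) ∧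
      (o u = false → Function.Bijective (b u)))} ≤ 2 := by
  by_cases h : (∀ u, o u = true → Function.Surjective (f u)) ∧
    (∀ u, o u = false → Function.Injective (b u))
  · have : {u | ¬ ((o u = true → Function.Bijective (f u)) ∧
      (o u = false → Function.Bijective (b u)))} = ∅ := by
      ext u
      simpa using dims o f b h.1 h.2 u
    rw [this]; simp
  · have : ∃ v l, ∀ u, u ≠ v → u ≠ l → (o u = true → Function.Bijective (f u)) ∧
      (o u = false → Function.Bijective (b u)) := by
      rw [not_and_or] at h
      rcases h with h | h
      · push Not at h
        obtain ⟨v, hv, h⟩ := h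
        exact ⟨v, finish o f b v _ _ (str_coker o f b v hv
          (fun hh => h (LinearMap.range_eq_top.1 hh))) (fun _ => le_rfl) (by simp [hv]) hind⟩
      · push Not at h
        obtain ⟨v, hv, h⟩ := h
        exact ⟨v, finish o f b v _ _ (str_ker o f b v hv
          (fun hh => h (LinearMap.ker_eq_bot.1 hh))) (by simp [hv]) (fun _ => le_rfl) hind⟩
    obtain ⟨v, l, hvl⟩ := this
    refine (Set.ncard_le_ncard (t := {v, l}) ?_ (Set.toFinite _)).trans (by
      simpa using Set.ncard_insert_le v {l})
    intro u hu
    by_contra hh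
    simp only [Set.mem_insert_iff, Set.mem_singleton_iff, not_or] at hh
    exact hu (hvl u hh.1 hh.2)

end abstract_cycle

section concrete

variable {t : ℕ} {ε : Fin t → Bool}

/-- Splitting data gives a direct sum decomposition. -/
theorem iso_of_split (X : Rep t ε) (k l : Fin t → ℕ)
    (JK : ∀ v, Matrix (Fin (X.d v)) (Fin (k v)) ℂ) (RK : ∀ v, Matrix (Fin (k v)) (Fin (X.d v)) ℂ)
    (JL : ∀ v, Matrix (Fin (X.d v)) (Fin (l v)) ℂ) (RL : ∀ v, Matrix (Fin (l v)) (Fin (X.d v)) ℂ)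
    (h1 : ∀ v, RK v * JK v = 1) (h2 : ∀ v, RL v * JL v = 1) (h3 : ∀ v, RK v * JL v = 0)
    (h4 : ∀ v, RL v * JK v = 0) (h5 : ∀ v, JK v * RK v + JL v * RL v = 1)
    (h6 : ∀ i, RL (tgt ε i) * X.A i * JK (src ε i) = 0)
    (h7 : ∀ i, RK (tgt ε i) * X.A i * JL (src ε i) = 0) :
    Iso X (dsum ⟨k, fun i => RK (tgt ε i) * X.A i * JK (src ε i)⟩ 
      ⟨l, fun i => RL (tgt ε i) * X.A i * JL (src ε i)⟩) := by
  let S : ∀ v, Matrix (Fin (k v + l v)) (Fin (X.d v)) ℂ := fun v =>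
    (Matrix.fromRows (RK v) (RL v)).submatrix finSumFinEquiv.symm id
  let T : ∀ v, Matrix (Fin (X.d v)) (Fin (k v + l v)) ℂ := fun v =>
    (Matrix.fromCols (JK v) (JL v)).submatrix id finSumFinEquiv.symm
  have a1 : ∀ v, S v * T v = 1 := by
    intro v
    simp only [S, T]
    rw [← Matrix.submatrix_mul _ _ _ id _ Function.bijective_id, Matrix.fromRows_mul_fromCols,
      h1, h2, h3, h4, Matrix.fromBlocks_one]
    exact Matrix.submatrix_one_equiv _
  have a2 : ∀ v, T v * S v = 1 := by
    intro v
    simp only [S, T]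
    rw [Matrix.submatrix_mul_equiv, Matrix.fromCols_mul_fromRows, h5, Matrix.submatrix_id_id]
  have a3 : ∀ i, Matrix.reindex finSumFinEquiv finSumFinEquiv
      (Matrix.fromBlocks (RK (tgt ε i) * X.A i * JK (src ε i)) 0 0
        (RL (tgt ε i) * X.A i * JL (src ε i))) = S (tgt ε i) * X.A i * T (src ε i) := by
    intro i
    have e : S (tgt ε i) * X.A i =
        (Matrix.fromRows (RK (tgt ε i)) (RL (tgt ε i)) * X.A i).submatrix
          finSumFinEquiv.symm id := rfl
    rw [e]
    simp only [T]
    rw [← Matrix.submatrix_mul _ _ _ id _ Function.bijective_id, Matrix.fromRows_mul,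
      Matrix.fromRows_mul_fromCols, h6, h7]
    rfl
  exact ⟨S, T, a1, a2, a3⟩

theorem exists_split {n : ℕ} (K L : Submodule ℂ (Fin n → ℂ)) (h : IsCompl K L) :
    ∃ (JK : Matrix (Fin n) (Fin (Module.finrank ℂ K)) ℂ)
      (RK : Matrix (Fin (Module.finrank ℂ K)) (Fin n) ℂ)
      (JL : Matrix (Fin n) (Fin (Module.finrank ℂ L)) ℂ)
      (RL : Matrix (Fin (Module.finrank ℂ L)) (Fin n) ℂ),
      RK * JK = 1 ∧ RL * JL = 1 ∧ RK * JL = 0 ∧ RL * JK = 0 ∧ JK * RK + JL * RL = 1 ∧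
      (∀ x, JK *ᵥ x ∈ K) ∧ (∀ x, JL *ᵥ x ∈ L) ∧ (∀ x ∈ K, RL *ᵥ x = 0) ∧
      (∀ x ∈ L, RK *ᵥ x = 0) := by
  let eK := (Module.finBasis ℂ K).equivFun
  let eL := (Module.finBasis ℂ L).equivFun
  let jK := K.subtype ∘ₗ eK.symm.toLinearMap
  let jL := L.subtype ∘ₗ eL.symm.toLinearMap
  let rK := eK.toLinearMap ∘ₗ K.projectionOnto L h
  let rL := eL.toLinearMap ∘ₗ L.projectionOnto K h.symm
  have a1 : ∀ x : Fin n → ℂ, x ∈ K → rL x = 0 := by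
    intro x hx
    simp [rL, (Submodule.projectionOnto_apply_eq_zero_iff h.symm).2 hx]
  have a2 : ∀ x : Fin n → ℂ, x ∈ L → rK x = 0 := by
    intro x hx
    simp [rK, (Submodule.projectionOnto_apply_eq_zero_iff h).2 hx]
  refine ⟨LinearMap.toMatrix' jK, LinearMap.toMatrix' rK, LinearMap.toMatrix' jL,
    LinearMap.toMatrix' rL, ?_, ?_, ?_, ?_, ?_, ?_, ?_, ?_, ?_⟩
  · rw [← LinearMap.toMatrix'_comp, ← LinearMap.toMatrix'_id]
    congr 1
    apply LinearMap.ext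
    intro x
    simp [jK, rK]
  · rw [← LinearMap.toMatrix'_comp, ← LinearMap.toMatrix'_id]
    congr 1
    apply LinearMap.ext
    intro x
    simp [jL, rL]
  · rw [← LinearMap.toMatrix'_comp, ← map_zero LinearMap.toMatrix']
    congr 1
    apply LinearMap.ext
    intro x
    exact a2 _ (by simp [jL])
  · rw [← LinearMap.toMatrix'_comp, ← map_zero LinearMap.toMatrix']
    congr 1
    apply LinearMap.ext
    intro x
    exact a1 _ (by simp [jK])
  · rw [← LinearMap.toMatrix'_comp, ← LinearMap.toMatrix'_comp, ← map_add,
      ← LinearMap.toMatrix'_id]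
    congr 1
    apply LinearMap.ext
    intro x
    obtain ⟨y, hy, z, hz, rfl⟩ := Submodule.mem_sup.1
      (show x ∈ K ⊔ L by rw [h.sup_eq_top]; trivial)
    have e1 : jK (rK y) = y := by
      have := Submodule.projectionOnto_apply_left h ⟨y, hy⟩
      simp only at this
      simp [jK, rK, this]
    have e2 : jL (rL z) = z := by
      have := Submodule.projectionOnto_apply_left h.symm ⟨z, hz⟩
      simp only at this
      simp [jL, rL, this]
    simp only [LinearMap.add_apply, LinearMap.comp_apply, map_add, a1 y hy, a2 z hz, e1, e2,
      map_zero, LinearMap.id_apply]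
    simp
  · intro x; rw [LinearMap.toMatrix'_mulVec]; simp [jK]
  · intro x; rw [LinearMap.toMatrix'_mulVec]; simp [jL]
  · intro x hx; rw [LinearMap.toMatrix'_mulVec]; exact a1 x hx
  · intro x hx; rw [LinearMap.toMatrix'_mulVec]; exact a2 x hx

theorem split_trivial (X : Rep t ε) (hX : Indecomposable X)
    (K L : ∀ v, Submodule ℂ (Fin (X.d v) → ℂ)) (h : ∀ v, IsCompl (K v) (L v))
    (hK : ∀ i, ∀ x ∈ K (src ε i), X.A i *ᵥ x ∈ K (tgt ε i))
    (hL : ∀ i, ∀ x ∈ L (src ε i), X.A i *ᵥ x ∈ L (tgt ε i)) :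
    (∀ v, K v = ⊥) ∨ (∀ v, L v = ⊥) := by
  by_contra hcon
  rw [not_or] at hcon
  obtain ⟨hc1, hc2⟩ := hcon
  push Not at hc1 hc2
  choose JK RK JL RL h1 h2 h3 h4 h5 h6 h7 h8 h9 using fun v => exists_split (K v) (L v) (h v)
  apply hX.2
  refine ⟨_, _, ?_, ?_, iso_of_split X _ _ JK RK JL RL h1 h2 h3 h4 h5 ?_ ?_⟩
  · obtain ⟨v, hv⟩ := hc1
    exact ⟨v, fun hh => hv (Submodule.finrank_eq_zero.1 hh)⟩
  · obtain ⟨v, hv⟩ := hc2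
    exact ⟨v, fun hh => hv (Submodule.finrank_eq_zero.1 hh)⟩
  · intro i
    apply Matrix.ext_of_mulVec_single
    intro j
    rw [← Matrix.mulVec_mulVec, ← Matrix.mulVec_mulVec, h8 _ _ (hK i _ (h6 _ _))]
    exact (Matrix.zero_mulVec _).symm
  · intro i
    apply Matrix.ext_of_mulVec_single
    intro j
    rw [← Matrix.mulVec_mulVec, ← Matrix.mulVec_mulVec, h9 _ _ (hL i _ (h7 _ _))]
    exact (Matrix.zero_mulVec _).symm

/-- Fitting's lemma for an indecomposable representation. -/
theorem fitting (X : Rep t ε) (hX : Indecomposable X)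
    (P : ∀ u, (Fin (X.d u) → ℂ) →ₗ[ℂ] (Fin (X.d u) → ℂ))
    (hP : ∀ i, P (tgt ε i) ∘ₗ (X.A i).mulVecLin = (X.A i).mulVecLin ∘ₗ P (src ε i))
    (htr : ∃ u, LinearMap.trace ℂ _ (P u) ≠ 0) (u : Fin t) : Function.Bijective (P u) := by
  have hev : ∀ᶠ n in Filter.atTop, ∀ v,
      IsCompl (LinearMap.ker (P v ^ n)) (LinearMap.range (P v ^ n)) :=
    Filter.eventually_all.2 fun v => (P v).eventually_isCompl_ker_pow_range_pow
  obtain ⟨n, hn, hn1⟩ := (hev.and (Filter.eventually_ge_atTop 1)).exists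
  have hpow : ∀ m i x, (P (tgt ε i) ^ m) (X.A i *ᵥ x) = X.A i *ᵥ ((P (src ε i) ^ m) x) := by
    intro m i
    induction m with
    | zero => intro x; simp
    | succ m ih =>
      intro x
      have := LinearMap.congr_fun (hP i) x
      simp only [LinearMap.comp_apply, Matrix.mulVecLin_apply] at this
      rw [pow_succ, Module.End.mul_apply, this, ih, pow_succ, Module.End.mul_apply]
  have hsp := split_trivial X hX _ _ hn
    (fun i x hx => by
      rw [LinearMap.mem_ker] at hx ⊢
      rw [hpow, hx]; simp)
    (by
      rintro i _ ⟨x, rfl⟩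
      exact ⟨X.A i *ᵥ x, hpow n i x⟩)
  rcases hsp with h | h
  · have hinj : Function.Injective (P u) := by
      have h0 := LinearMap.ker_eq_bot.1 (h u)
      obtain ⟨m, rfl⟩ : ∃ m, n = m + 1 := ⟨n - 1, by omega⟩
      rw [pow_succ, Module.End.coe_mul] at h0
      exact h0.of_comp
    exact ⟨hinj, LinearMap.injective_iff_surjective.1 hinj⟩
  · exfalso
    obtain ⟨v, hv⟩ := htr
    apply hv
    have h0 := LinearMap.range_eq_bot.1 (h v)
    exact (LinearMap.isNilpotent_trace_of_isNilpotent ⟨n, h0⟩).eq_zero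

theorem next_injective : Function.Injective (next : Fin t → Fin t) := by
  intro a c h
  have h : ((a : ℕ) + 1) % t = ((c : ℕ) + 1) % t := congrArg Fin.val h
  have h' : (a : ℕ) ≡ c [MOD t] := Nat.ModEq.add_right_cancel' 1 h
  exact Fin.ext (Nat.ModEq.eq_of_lt_of_lt h' a.2 c.2)

/-- The cyclic successor as a permutation. -/
noncomputable def nextPerm (t : ℕ) : Equiv.Perm (Fin t) :=
  Equiv.ofBijective next (Finite.injective_iff_bijective.1 next_injective)

/-- Change of endpoints of a linear map. -/
def castLM (d : Fin t → ℕ) {s e i j : Fin t} (hs : s = i) (he : e = j)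
    (a : (Fin (d s) → ℂ) →ₗ[ℂ] (Fin (d e) → ℂ)) : (Fin (d i) → ℂ) →ₗ[ℂ] (Fin (d j) → ℂ) :=
  hs ▸ he ▸ a

theorem castLM_bij (d : Fin t → ℕ) {s e i j : Fin t} (hs : s = i) (he : e = j)
    (a : (Fin (d s) → ℂ) →ₗ[ℂ] (Fin (d e) → ℂ)) :
    Function.Bijective (castLM d hs he a) ↔ Function.Bijective a := by
  subst hs he; rfl

theorem castLM_comm (d : Fin t → ℕ) {s e i j : Fin t} (hs : s = i) (he : e = j)
    (a : (Fin (d s) → ℂ) →ₗ[ℂ] (Fin (d e) → ℂ))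
    (P : ∀ u, (Fin (d u) → ℂ) →ₗ[ℂ] (Fin (d u) → ℂ))
    (h : P j ∘ₗ castLM d hs he a = castLM d hs he a ∘ₗ P i) : P e ∘ₗ a = a ∘ₗ P s := by
  subst hs he; exact h

theorem inverse_of_bijective {m n : ℕ} (A : Matrix (Fin m) (Fin n) ℂ)
    (h : Function.Bijective A.mulVecLin) :
    ∃ B : Matrix (Fin n) (Fin m) ℂ, A * B = 1 ∧ B * A = 1 := by
  let e := LinearEquiv.ofBijective A.mulVecLin h
  have hA : A = LinearMap.toMatrix' e.toLinearMap := by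
    conv_lhs => rw [← LinearMap.toMatrix'_toLin' A]
    rfl
  refine ⟨LinearMap.toMatrix' e.symm.toLinearMap, ?_, ?_⟩
  · rw [hA, ← LinearMap.toMatrix'_comp, ← LinearMap.toMatrix'_id]
    congr 1
    apply LinearMap.ext
    intro x
    simp
  · rw [hA, ← LinearMap.toMatrix'_comp, ← LinearMap.toMatrix'_id]
    congr 1
    apply LinearMap.ext
    intro x
    simp

end concrete


/-- If a matrix representation of the cycle quiver (`t ≥ 2`, arbitrary orientation) is
indecomposable, then at most `2` of its `t` matrices fail to be square invertible,
i.e. at least `t - 2` of them are square and invertible. -/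
theorem cycle_indecomposable_at_most_two_singular (t : ℕ) (ht : 2 ≤ t)
    (ε : Fin t → Bool) (X : Rep t ε) (hX : Indecomposable X) :
    Set.ncard {i : Fin t |
      ¬ ∃ B : Matrix (Fin (X.d (src ε i))) (Fin (X.d (tgt ε i))) ℂ,
          X.A i * B = 1 ∧ B * X.A i = 1} ≤ 2 := by
  classical
  have hs1 : ∀ i, ε i = true → src ε i = i := fun i h => by simp [src, h]
  have ht1 : ∀ i, ε i = true → tgt ε i = nextPerm t i := fun i h => by
    simp [tgt, h, nextPerm]
  have hs2 : ∀ i, ε i = false → src ε i = nextPerm t i := fun i h => by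
    simp [src, h, nextPerm]
  have ht2 : ∀ i, ε i = false → tgt ε i = i := fun i h => by simp [tgt, h]
  let f : ∀ u, (Fin (X.d u) → ℂ) →ₗ[ℂ] (Fin (X.d (nextPerm t u)) → ℂ) := fun u =>
    if h : ε u = true then castLM X.d (hs1 u h) (ht1 u h) (X.A u).mulVecLin else 0
  let b : ∀ u, (Fin (X.d (nextPerm t u)) → ℂ) →ₗ[ℂ] (Fin (X.d u) → ℂ) := fun u =>
    if h : ε u = false then castLM X.d (hs2 u h) (ht2 u h) (X.A u).mulVecLin else 0
  have hf : ∀ u (h : ε u = true), f u = castLM X.d (hs1 u h) (ht1 u h) (X.A u).mulVecLin :=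
    fun u h => dif_pos h
  have hb : ∀ u (h : ε u = false), b u = castLM X.d (hs2 u h) (ht2 u h) (X.A u).mulVecLin :=
    fun u h => dif_pos h
  have main := abstract_main (V := fun u => Fin (X.d u) → ℂ) ε f b (fun P hP1 hP2 htr =>
    fitting X hX P (fun i => by
      cases h : ε i
      · apply castLM_comm X.d (hs2 i h) (ht2 i h)
        rw [← hb i h]
        exact hP2 i h
      · apply castLM_comm X.d (hs1 i h) (ht1 i h)
        rw [← hf i h]
        exact hP1 i h) htr)
  refine (Set.ncard_le_ncard ?_ (Set.toFinite _)).trans main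
  intro i hi hcon
  apply hi
  apply inverse_of_bijective
  cases h : ε i
  · have := hcon.2 h
    rw [hb i h] at this
    exact (castLM_bij X.d _ _ _).1 this
  · have := hcon.1 h
    rw [hf i h] at this
    exact (castLM_bij X.d _ _ _).1 this

end CycleQuiver
end
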